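/- arXiv:1805.05996 — 2 statements merged into one kernel-verified Lean document; each statement's English description precedes it below -/
import Mathlib

section
/- Let G be a Δ-critical simple graph, ε ∈ (0,1), q = (1−ε)Δ, and let xy ∈ E(G) with d(x) < εΔ and φ ∈ C^Δ(G−xy). Then for every z ∈ N(x, M_φ), one has φ_b(z) − {φ(xz)} ⊆ B_φ(x,y,q). Moreover, for any two distinct z₁, z₂ ∈ N(x, M_φ), one has φ_b(z₁) ∩ φ_b(z₂) = ∅. -/
open Finset

variable {V : Type*}

/-- `φ` is a proper edge coloring of `G` with colors in `{1, …, k}`, encoded as a symmetric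
function on ordered pairs of vertices: every edge receives a color in `[1,k]` and two distinct
edges sharing a vertex receive different colors. -/
def IsEdgeColoring (G : SimpleGraph V) (k : ℕ) (φ : V → V → ℕ) : Prop :=
  (∀ u v, φ u v = φ v u) ∧
  (∀ ⦃u v⦄, G.Adj u v → φ u v ∈ Finset.Icc 1 k) ∧
  (∀ ⦃v a b⦄, G.Adj v a → G.Adj v b → a ≠ b → φ v a ≠ φ v b)

/-- The chromatic index of `G`: the least `k` such that `G` has a proper edge `k`-coloring. -/
noncomputable def chromIndex (G : SimpleGraph V) : ℕ :=
  sInf {k | ∃ φ : V → V → ℕ, IsEdgeColoring G k φ}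

/-- `G` is `Δ`-critical: `G` is connected, `χ'(G) = Δ + 1`, and `χ'(G - e) = Δ` for every
edge `e` of `G`, where `Δ` is the maximum degree of `G`. -/
def IsDeltaCritical [Fintype V] (G : SimpleGraph V) [DecidableRel G.Adj] : Prop :=
  G.Connected ∧ chromIndex G = G.maxDegree + 1 ∧
    ∀ e ∈ G.edgeSet, chromIndex (G.deleteEdges {e}) = G.maxDegree

/-- The independence number of `G`. -/
noncomputable def indepNum [Fintype V] (G : SimpleGraph V) : ℕ :=
  sSup {n | ∃ s : Finset V, (∀ u ∈ s, ∀ v ∈ s, u ≠ v → ¬ G.Adj u v) ∧ s.card = n}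

/-- The set of colors present at `v` in the graph `H` under the coloring `φ`. -/
def present (H : SimpleGraph V) (φ : V → V → ℕ) (v : V) : Set ℕ :=
  {c | ∃ u, H.Adj v u ∧ φ v u = c}

/-- The set of colors in `[1,Δ]` missing at `v` in the graph `H` under the coloring `φ`. -/
def missing (H : SimpleGraph V) (Δ : ℕ) (φ : V → V → ℕ) (v : V) : Set ℕ :=
  Set.Icc 1 Δ \ present H φ v

variable [Fintype V]

/-- `A_φ(x,y,q)`: colors `α` present at `x` such that some colored edge `yu` has color `α`
with `d(u) < q` (degrees taken in `G`, the coloring living on `H = G - xy`). -/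
def Aset (G H : SimpleGraph V) [DecidableRel G.Adj] (φ : V → V → ℕ) (q : ℝ) (x y : V) :
    Set ℕ :=
  {α | α ∈ present H φ x ∧ ∃ u, H.Adj y u ∧ φ y u = α ∧ (G.degree u : ℝ) < q}

/-- `B_φ(x,y,q)`: colors `β` present at `x` such that some colored edge `yu` has color `β`
with `d(u) ≥ q`. -/
def Bset (G H : SimpleGraph V) [DecidableRel G.Adj] (φ : V → V → ℕ) (q : ℝ) (x y : V) :
    Set ℕ :=
  {β | β ∈ present H φ x ∧ ∃ u, H.Adj y u ∧ φ y u = β ∧ q ≤ (G.degree u : ℝ)}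

/-- `M_φ(x,y,q) = A_φ(x,y,q) ∪ φ̄(x) ∪ φ̄(y)`. -/
def Mset (G H : SimpleGraph V) [DecidableRel G.Adj] (Δ : ℕ) (φ : V → V → ℕ) (q : ℝ)
    (x y : V) : Set ℕ :=
  Aset G H φ q x y ∪ missing H Δ φ x ∪ missing H Δ φ y

/-- `N(x, M_φ)`: neighbors `z` of `x` (in `H = G - xy`) with `φ(xz) ∈ M_φ(x,y,q)`. -/
def NxM (G H : SimpleGraph V) [DecidableRel G.Adj] (Δ : ℕ) (φ : V → V → ℕ) (q : ℝ)
    (x y : V) : Set V :=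
  {z | H.Adj x z ∧ φ x z ∈ Mset G H Δ φ q x y}

/-- `N(x, B_φ)`: neighbors `z` of `x` (in `H = G - xy`) with `φ(xz) ∈ B_φ(x,y,q)`. -/
def NxB (G H : SimpleGraph V) [DecidableRel G.Adj] (φ : V → V → ℕ) (q : ℝ) (x y : V) :
    Set V :=
  {z | H.Adj x z ∧ φ x z ∈ Bset G H φ q x y}

/-- `φ_b(v)`: colors `α ∈ [1,Δ]` that are either missing at `v`, or appear on a colored edge
`vv'` with `d(v') < q`. -/
def phib (G H : SimpleGraph V) [DecidableRel G.Adj] (Δ : ℕ) (φ : V → V → ℕ) (q : ℝ)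
    (v : V) : Set ℕ :=
  {α | α ∈ Set.Icc 1 Δ ∧
    (α ∉ present H φ v ∨ ∃ v', H.Adj v v' ∧ φ v v' = α ∧ (G.degree v' : ℝ) < q)}

/-! ### Kempe chains -/

/-- Missing at one of the two colours. -/
def KEnd (K : SimpleGraph V) (ψ : V → V → ℕ) (i j : ℕ) (v : V) : Prop :=
  i ∉ present K ψ v ∨ j ∉ present K ψ v

/-- The two-coloured subgraph. -/
def kgraph (K : SimpleGraph V) (ψ : V → V → ℕ) (hs : ∀ u v, ψ u v = ψ v u) (i j : ℕ) :
    SimpleGraph V where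
  Adj u v := K.Adj u v ∧ (ψ u v = i ∨ ψ u v = j)
  symm := ⟨by
    rintro u v ⟨h1, h2⟩
    exact ⟨h1.symm, by rwa [hs v u]⟩⟩
  loopless := ⟨by
    rintro u ⟨h, _⟩
    exact K.loopless.irrefl u h⟩

/-- In a graph of maximum degree at most two a component contains at most two vertices of
degree at most one. -/
theorem three_ends (L : SimpleGraph V)
    (h2 : ∀ w a b c, L.Adj w a → L.Adj w b → L.Adj w c → a ≠ b → c = a ∨ c = b)
    {a b c : V} (ha : ∀ s t, L.Adj a s → L.Adj a t → s = t)
    (hb : ∀ s t, L.Adj b s → L.Adj b t → s = t)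
    (hc : ∀ s t, L.Adj c s → L.Adj c t → s = t)
    (hab : L.Reachable a b) (hac : L.Reachable a c)
    (nab : a ≠ b) (nac : a ≠ c) (nbc : b ≠ c) : False := by
  classical
  obtain ⟨p, hp⟩ := hab.exists_isPath
  have hlen : 0 < p.length := by
    rcases Nat.eq_zero_or_pos p.length with h | h
    · exact absurd (SimpleGraph.Walk.eq_of_length_eq_zero h) nab
    · exact h
  have hintr : ∀ k, 0 < k → k < p.length →
      L.Adj (p.getVert k) (p.getVert (k-1)) ∧ L.Adj (p.getVert k) (p.getVert (k+1)) ∧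
      p.getVert (k-1) ≠ p.getVert (k+1) := by
    intro k h0 hk
    refine ⟨?_, p.adj_getVert_succ hk, ?_⟩
    · have := p.adj_getVert_succ (i := k-1) (by omega)
      rw [Nat.sub_add_cancel h0] at this
      exact this.symm
    · intro h
      have := hp.getVert_injOn (by simp; omega) (by simp; omega) h
      omega
  have hcl : ∀ w w', w ∈ p.support → L.Adj w w' → w' ∈ p.support := by
    intro w w' hw hadj
    rw [SimpleGraph.Walk.mem_support_iff_exists_getVert] at hw
    obtain ⟨k, rfl, hk⟩ := hw
    rcases Nat.eq_zero_or_pos k with rfl | h0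
    · have h1 := p.adj_getVert_succ hlen
      rw [SimpleGraph.Walk.getVert_zero] at h1 hadj
      rw [ha _ _ hadj h1]
      exact p.getVert_mem_support _
    · rcases Nat.lt_or_ge k p.length with h | h
      · obtain ⟨e1, e2, e3⟩ := hintr k h0 h
        rcases h2 _ _ _ _ e1 e2 hadj e3 with r | r <;> rw [r] <;> exact p.getVert_mem_support _
      · have hk' : k = p.length := le_antisymm hk h
        subst hk'
        have h1 := p.adj_getVert_succ (i := p.length - 1) (by omega)
        rw [Nat.sub_add_cancel hlen, SimpleGraph.Walk.getVert_length] at h1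
        rw [SimpleGraph.Walk.getVert_length] at hadj
        rw [hb _ _ hadj h1.symm]
        exact p.getVert_mem_support _
  have hcs : ∀ u v, L.Walk u v → u ∈ p.support → v ∈ p.support := by
    intro u v q
    induction q with
    | nil => exact id
    | cons h q ih => exact fun hu => ih (hcl _ _ hu h)
  obtain ⟨q⟩ := hac
  have := hcs _ _ q p.start_mem_support
  rw [SimpleGraph.Walk.mem_support_iff_exists_getVert] at this
  obtain ⟨k, hk, hkl⟩ := this
  have h0 : 0 < k := by
    rcases Nat.eq_zero_or_pos k with rfl | h
    · rw [SimpleGraph.Walk.getVert_zero] at hk; exact absurd hk nac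
    · exact h
  have h1 : k < p.length := by
    rcases Nat.lt_or_ge k p.length with h | h
    · exact h
    · have hk' : k = p.length := le_antisymm hkl h
      rw [hk', SimpleGraph.Walk.getVert_length] at hk
      exact absurd hk nbc
  obtain ⟨e1, e2, e3⟩ := hintr k h0 h1
  rw [hk] at e1 e2
  exact e3 (hc _ _ e1 e2)

theorem kempe (K : SimpleGraph V) (k : ℕ) (ψ : V → V → ℕ) (hψ : IsEdgeColoring K k ψ)
    (i j : ℕ) (hi : i ∈ Finset.Icc 1 k) (hj : j ∈ Finset.Icc 1 k) :
    ∃ r : V → V → Prop, Equivalence r ∧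
      (∀ a b c, r a b → r a c → a ≠ b → a ≠ c → b ≠ c →
        KEnd K ψ i j a → KEnd K ψ i j b → KEnd K ψ i j c → False) ∧
      ∀ T : Set V, (∀ a b, r a b → a ∈ T → b ∈ T) → ∃ ψ', IsEdgeColoring K k ψ' ∧
        (∀ u v, K.Adj u v → u ∈ T → ψ' u v = Equiv.swap i j (ψ u v)) ∧
        (∀ u v, K.Adj u v → u ∉ T → ψ' u v = ψ u v) := by
  classical
  obtain ⟨hs, hr, hp⟩ := hψ
  set L := kgraph K ψ hs i j with hL
  have hend : ∀ a, KEnd K ψ i j a → ∀ s t, L.Adj a s → L.Adj a t → s = t := by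
    intro a ha s t h1 h2
    by_contra hne
    obtain ⟨k1, c1⟩ := h1
    obtain ⟨k2, c2⟩ := h2
    have := hp k1 k2 hne
    rcases ha with ha | ha
    · have n1 : ψ a s ≠ i := fun h => ha ⟨s, k1, h⟩
      have n2 : ψ a t ≠ i := fun h => ha ⟨t, k2, h⟩
      simp_all
    · have n1 : ψ a s ≠ j := fun h => ha ⟨s, k1, h⟩
      have n2 : ψ a t ≠ j := fun h => ha ⟨t, k2, h⟩
      simp_all
  refine ⟨L.Reachable, SimpleGraph.reachable_is_equivalence L, ?_, ?_⟩
  · intro a b c hab hac nab nac nbc ea eb ec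
    refine three_ends L ?_ (hend a ea) (hend b eb) (hend c ec) hab hac nab nac nbc
    rintro w a b c ⟨a1, a2⟩ ⟨b1, b2⟩ ⟨c1, c2⟩ hne
    by_contra hcon
    push Not at hcon
    have h1 := hp a1 b1 hne
    have h2 := hp c1 a1 hcon.1
    have h3 := hp c1 b1 hcon.2
    rcases a2 with a2 | a2 <;> rcases b2 with b2 | b2 <;> rcases c2 with c2 | c2 <;> simp_all
  · intro T hT
    have key : ∀ u v, K.Adj u v → u ∈ T → v ∉ T → Equiv.swap i j (ψ u v) = ψ u v := by
      intro u v huv hu hv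
      apply Equiv.swap_apply_of_ne_of_ne
      · intro h
        exact hv (hT u v (SimpleGraph.Adj.reachable (G := L) ⟨huv, Or.inl h⟩) hu)
      · intro h
        exact hv (hT u v (SimpleGraph.Adj.reachable (G := L) ⟨huv, Or.inr h⟩) hu)
    refine ⟨fun u v => if K.Adj u v ∧ u ∈ T then Equiv.swap i j (ψ u v) else ψ u v,
      ⟨?_, ?_, ?_⟩, ?_, ?_⟩
    · intro u v
      by_cases huv : K.Adj u v
      · have hvu := huv.symm
        by_cases hu : u ∈ T <;> by_cases hv : v ∈ T
        · simp [huv, hvu, hu, hv, hs u v]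
        · simp [huv, hvu, hu, hv, hs v u, key u v huv hu hv]
        · have := key v u hvu hv hu
          simp [huv, hvu, hu, hv, hs u v, this]
        · simp [hu, hv, hs u v]
      · have hvu : ¬ K.Adj v u := fun h => huv h.symm
        simp [huv, hvu, hs u v]
    · intro u v huv
      dsimp only
      split_ifs
      · show Equiv.swap i j (ψ u v) ∈ _
        by_cases h1 : ψ u v = i
        · rw [h1, Equiv.swap_apply_left]; exact hj
        · by_cases h2 : ψ u v = j
          · rw [h2, Equiv.swap_apply_right]; exact hi
          · rw [Equiv.swap_apply_of_ne_of_ne h1 h2]; exact hr huv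
      · exact hr huv
    · intro v a b ha hb hne
      by_cases hv : v ∈ T
      · simp [ha, hb, hv, hp ha hb hne]
      · simp [hv, hp ha hb hne]
    · intro u v huv hu
      simp [huv, hu]
    · intro u v huv hu
      simp [hu]

/-! ### The recolouring game -/

/-- Certificates for winning strategies. -/
inductive Cert where
  | fin (f : List ℕ)
  | swap (i j : ℕ) (l : Cert)
  | br (m : ℕ) (c r : Cert)
  | nil

/-- The list of masks of a list of branches. -/
def Cert.masks : Cert → List ℕ
  | .br m _ r => m :: r.masks
  | _ => []

/-- Whether a certificate is a genuine node. -/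
def Cert.isNode : Cert → Bool
  | .fin _ => true
  | .swap _ _ _ => true
  | _ => false

/-- A block is contained in or disjoint from the mask. -/
def blockOK (m : ℕ) (b : List ℕ) : Bool :=
  b.all (fun a => m.testBit a) || b.all (fun a => !m.testBit a)

/-- For every way to pair up the ends, some mask is a union of blocks. -/
def matchOK (ms : List ℕ) : ℕ → List ℕ → List (List ℕ) → Bool
  | 0, _, _ => false
  | _ + 1, [], bl => ms.any (fun m => bl.all (blockOK m))
  | f + 1, a :: rem, bl => matchOK ms f rem ([a] :: bl) &&
      rem.all (fun b => matchOK ms f (rem.erase b) ([a, b] :: bl))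

/-- Final check: colour all core edges. -/
def finOK (n : ℕ) (core : List (ℕ × ℕ)) (f : List ℕ) (P : List ℕ) : Bool :=
  (core.length == f.length) &&
  (core.zip f).all (fun e => e.1.1 < n && e.1.2 < n && e.2 < P.length &&
    (P.getD e.2 0).testBit e.1.1 && (P.getD e.2 0).testBit e.1.2) &&
  (core.zip f).all (fun e => (core.zip f).all (fun e' => e == e' || e.2 != e'.2 ||
    (e.1.1 != e'.1.1 && e.1.1 != e'.1.2 && e.1.2 != e'.1.1 && e.1.2 != e'.1.2)))

/-- Flip the ends in a mask. -/
def flipS (P : List ℕ) (i j m : ℕ) : List ℕ :=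
  (P.set i ((P.getD i 0) ^^^ m)).set j ((P.getD j 0) ^^^ m)

/-- The ends of the chains. -/
def endsS (n : ℕ) (P : List ℕ) (i j : ℕ) : List ℕ :=
  (List.range n).filter (fun a => ((P.getD i 0).testBit a) ^^ ((P.getD j 0).testBit a))

/-- The checker. -/
def runC (n : ℕ) (core : List (ℕ × ℕ)) : Cert → ℕ → ℕ → List ℕ → Bool
  | .fin f, _, _, P => finOK n core f P
  | .swap i j l, _, _, P => i != j && i < P.length && j < P.length &&
      matchOK l.masks (n + 1) (endsS n P i j) [] && 
      l.masks.all (fun m => (List.range n).all (fun a => !m.testBit a ||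
        ((P.getD i 0).testBit a ^^ ((P.getD j 0).testBit a)))) && runC n core l i j P
  | .br m c r, i, j, P => c.isNode && runC n core c 0 0 (flipS P i j m) && runC n core r i j P
  | .nil, _, _, _ => true

/-! ### Soundness of the checker -/

theorem matchOK_sound (r : ℕ → ℕ → Prop) (hr : Equivalence r) (ms : List ℕ) :
    ∀ (f : ℕ) (rem : List ℕ) (bl : List (List ℕ)), matchOK ms f rem bl = true → rem.Nodup →
      (∀ a ∈ rem, ∀ b ∈ rem, ∀ c ∈ rem, r a b → r a c → a ≠ b → a ≠ c → b ≠ c → False) →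
      ∃ m ∈ ms, (∀ b ∈ bl, blockOK m b = true) ∧
        ∀ a ∈ rem, ∀ b ∈ rem, r a b → m.testBit a = true → m.testBit b = true := by
  intro f
  induction f with
  | zero => intro rem bl h; simp [matchOK] at h
  | succ f ih =>
    intro rem bl h hnd h3
    cases rem with
    | nil =>
      simp only [matchOK, List.any_eq_true, List.all_eq_true] at h
      obtain ⟨m, hm, h⟩ := h
      exact ⟨m, hm, h, by simp⟩
    | cons a rem =>
      simp only [matchOK, Bool.and_eq_true, List.all_eq_true] at h
      obtain ⟨h1, h2⟩ := h
      have hnd' := List.nodup_cons.mp hnd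
      by_cases hb : ∃ b ∈ rem, r a b
      · obtain ⟨b, hb, hab⟩ := hb
        obtain ⟨m, hm, hbl, hcl⟩ := ih _ _ (h2 b hb) (hnd'.2.erase b) (by
          intro a' ha' b' hb' c' hc'
          exact h3 a' (List.mem_cons_of_mem _ (List.mem_of_mem_erase ha'))
            b' (List.mem_cons_of_mem _ (List.mem_of_mem_erase hb'))
            c' (List.mem_cons_of_mem _ (List.mem_of_mem_erase hc')))
        have hblk : m.testBit a = m.testBit b := by
          have := hbl [a, b] (by simp)
          simp only [blockOK, List.all_cons, List.all_nil] at this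
          revert this
          cases m.testBit a <;> cases m.testBit b <;> simp
        have hne : a ≠ b := by rintro rfl; exact hnd'.1 hb
        refine ⟨m, hm, fun b' hb' => hbl b' (List.mem_cons_of_mem _ hb'), ?_⟩
        have hthird : ∀ c ∈ a :: rem, r a c → c = a ∨ c = b := by
          intro c hc hac
          by_contra hcon
          push Not at hcon
          exact h3 a (by simp) b (by simp [hb]) c hc hab hac hne (Ne.symm hcon.1)
            (Ne.symm hcon.2)
        intro p hp q hq hpq hmp
        by_cases hap : r a p
        · have haq := hr.trans hap hpq
          rcases hthird p hp hap with rfl | rfl <;> rcases hthird q hq haq with rfl | rfl <;>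
            simp_all
        · have haq : ¬ r a q := fun h => hap (hr.trans h (hr.symm hpq))
          have e : ∀ c, c ∈ a :: rem → ¬ r a c → c ∈ rem.erase b := by
            intro c hc hac
            have c1 : c ≠ a := by rintro rfl; exact hac (hr.refl _)
            have c2 : c ≠ b := by rintro rfl; exact hac hab
            rcases List.mem_cons.mp hc with h | h
            · exact absurd h c1
            · exact (List.mem_erase_of_ne c2).mpr h
          exact hcl p (e p hp hap) q (e q hq haq) hpq hmp
      · push Not at hb
        obtain ⟨m, hm, hbl, hcl⟩ := ih _ _ h1 hnd'.2 (by
          intro a' ha' b' hb' c' hc'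
          exact h3 a' (List.mem_cons_of_mem _ ha')
            b' (List.mem_cons_of_mem _ hb') c' (List.mem_cons_of_mem _ hc'))
        refine ⟨m, hm, fun b' hb' => hbl b' (List.mem_cons_of_mem _ hb'), ?_⟩
        intro p hp q hq hpq hmp
        rcases List.mem_cons.mp hp with h1 | h1 <;> rcases List.mem_cons.mp hq with h2 | h2
        · rwa [h2, ← h1]
        · exact absurd (h1 ▸ hpq) (hb _ h2)
        · exact absurd (hr.symm (h2 ▸ hpq)) (hb _ h1)
        · exact hcl p h1 q h2 hpq hmp

/-- The state `P` records colours missing at core vertices. -/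
def Holds (n : ℕ) (vs : ℕ → V) (cs : ℕ → ℕ) (K : SimpleGraph V) (ψ : V → V → ℕ)
    (P : List ℕ) : Prop :=
  ∀ i < P.length, ∀ a < n, (P.getD i 0).testBit a = true → cs i ∉ present K ψ (vs a)

theorem fin_sound (G K : SimpleGraph V) (k n N : ℕ) (vs : ℕ → V) (cs : ℕ → ℕ)
    (core : List (ℕ × ℕ))
    (hvs : ∀ a < n, ∀ b < n, vs a = vs b → a = b)
    (hcs : ∀ a < N, ∀ b < N, cs a = cs b → a = b)
    (hck : ∀ a < N, cs a ∈ Finset.Icc 1 k)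
    (hcore : ∀ u v, G.Adj u v → K.Adj u v ∨ ∃ e ∈ core, s(u, v) = s(vs e.1, vs e.2))
    (f P : List ℕ) (hP : P.length = N) (h : finOK n core f P = true)
    (ψ : V → V → ℕ) (hψ : IsEdgeColoring K k ψ) (hH : Holds n vs cs K ψ P) :
    ∃ φ, IsEdgeColoring G k φ := by
  classical
  simp only [finOK, Bool.and_eq_true, List.all_eq_true, beq_iff_eq, decide_eq_true_eq,
    Bool.or_eq_true, bne_iff_ne] at h
  obtain ⟨⟨hlen, h1⟩, h2⟩ := h
  obtain ⟨hs, hrg, hp⟩ := hψ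
  let φ : V → V → ℕ := fun u v =>
    match (core.zip f).find? (fun e => decide (s(u, v) = s(vs e.1.1, vs e.1.2))) with
    | some e => cs e.2
    | none => ψ u v
  have hφ : ∀ u v, G.Adj u v →
      (∃ e ∈ core.zip f, s(u, v) = s(vs e.1.1, vs e.1.2) ∧ φ u v = cs e.2) ∨
      (K.Adj u v ∧ φ u v = ψ u v) := by
    intro u v huv
    cases hf : (core.zip f).find? (fun e => decide (s(u, v) = s(vs e.1.1, vs e.1.2))) with
    | some e =>
      left
      refine ⟨e, List.mem_of_find?_eq_some hf, ?_, ?_⟩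
      · have := List.find?_some hf
        simpa using this
      · simp only [φ, hf]
    | none =>
      right
      refine ⟨?_, by simp only [φ, hf]⟩
      rcases hcore u v huv with h | ⟨e, he, heq⟩
      · exact h
      · exfalso
        rw [List.find?_eq_none] at hf
        obtain ⟨i, hi, rfl⟩ := List.getElem_of_mem he
        have hi' : i < (core.zip f).length := by simp; omega
        have := hf _ (List.getElem_mem hi')
        rw [List.getElem_zip] at this
        exact this (by simpa using heq)
  have hmiss : ∀ e ∈ core.zip f, ∀ v a, s(v, a) = s(vs e.1.1, vs e.1.2) →
      cs e.2 ∉ present K ψ v := by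
    intro e he v a hva
    obtain ⟨⟨⟨⟨e1, e2⟩, e3⟩, e4⟩, e5⟩ := h1 e he
    rw [Sym2.eq_iff] at hva
    rcases hva with ⟨rfl, -⟩ | ⟨rfl, -⟩
    · exact hH _ e3 _ e1 e4
    · exact hH _ e3 _ e2 e5
  refine ⟨φ, ?_, ?_, ?_⟩
  · intro u v
    simp only [φ, Sym2.eq_swap (a := u) (b := v), hs u v]
  · intro u v huv
    rcases hφ u v huv with ⟨e, he, -, h⟩ | ⟨h, h'⟩
    · rw [h]
      obtain ⟨⟨⟨⟨e1, e2⟩, e3⟩, e4⟩, e5⟩ := h1 e he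
      exact hck _ (hP ▸ e3)
    · rw [h']; exact hrg h
  · intro v a b hva hvb hab
    rcases hφ v a hva with ⟨e, he, hea, h⟩ | ⟨h, h'⟩ <;>
      rcases hφ v b hvb with ⟨e', he', heb, g⟩ | ⟨g, g'⟩
    · rw [h, g]
      intro hc
      obtain ⟨⟨⟨⟨e1, e2⟩, e3⟩, e4⟩, e5⟩ := h1 e he
      obtain ⟨⟨⟨⟨f1, f2⟩, f3⟩, f4⟩, f5⟩ := h1 e' he'
      have hc' := hcs _ (hP ▸ e3) _ (hP ▸ f3) hc
      rcases h2 e he e' he' with (h | h) | h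
      · subst h
        rw [← hea, Sym2.eq_iff] at heb
        rcases heb with ⟨-, h⟩ | ⟨h, h'⟩
        · exact hab h.symm
        · subst h; exact hab h'.symm
      · exact h hc'
      · obtain ⟨⟨⟨n1, n2⟩, n3⟩, n4⟩ := h
        rw [Sym2.eq_iff] at hea heb
        rcases hea with ⟨p, -⟩ | ⟨p, -⟩ <;> rcases heb with ⟨q, -⟩ | ⟨q, -⟩
        · exact n1 (hvs _ e1 _ f1 (p.symm.trans q))
        · exact n2 (hvs _ e1 _ f2 (p.symm.trans q))
        · exact n3 (hvs _ e2 _ f1 (p.symm.trans q))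
        · exact n4 (hvs _ e2 _ f2 (p.symm.trans q))
    · rw [h, g']
      intro hc
      exact hmiss e he v a hea ⟨b, g, hc.symm⟩
    · rw [g, h']
      intro hc
      exact hmiss e' he' v b heb ⟨a, h, hc⟩
    · rw [h', g']; exact hp h g hab

theorem swap_sound (K : SimpleGraph V) (k n N : ℕ) (vs : ℕ → V) (cs : ℕ → ℕ)
    (hvs : ∀ a < n, ∀ b < n, vs a = vs b → a = b)
    (hcs : ∀ a < N, ∀ b < N, cs a = cs b → a = b)
    (hck : ∀ a < N, cs a ∈ Finset.Icc 1 k)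
    (P ms : List ℕ) (hP : P.length = N) (i j : ℕ) (hij : i ≠ j) (hi : i < N) (hj : j < N)
    (h : matchOK ms (n + 1) (endsS n P i j) [] = true)
    (hsub : ∀ m ∈ ms, ∀ a < n, m.testBit a = true →
        ((P.getD i 0).testBit a ^^ ((P.getD j 0).testBit a)) = true)
    (ψ : V → V → ℕ) (hψ : IsEdgeColoring K k ψ) (hH : Holds n vs cs K ψ P) :
    ∃ m ∈ ms, ∃ ψ', IsEdgeColoring K k ψ' ∧ Holds n vs cs K ψ' (flipS P i j m) := by
  obtain ⟨r, hr, h3, hsw⟩ := kempe K k ψ hψ (cs i) (cs j) (hck i hi) (hck j hj)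
  have hends : ∀ a ∈ endsS n P i j, a < n ∧ KEnd K ψ (cs i) (cs j) (vs a) := by
    intro a ha
    simp only [endsS, List.mem_filter, List.mem_range] at ha
    refine ⟨ha.1, ?_⟩
    cases hb : (P.getD i 0).testBit a with
    | true => exact Or.inl (hH i (hP ▸ hi) a ha.1 hb)
    | false =>
      have := ha.2
      rw [hb, Bool.false_xor] at this
      exact Or.inr (hH j (hP ▸ hj) a ha.1 this)
  obtain ⟨m, hm, -, hcl⟩ := matchOK_sound (fun a b => r (vs a) (vs b))
    ⟨fun a => hr.refl _, fun h => hr.symm h, fun h h' => hr.trans h h'⟩ ms _ _ _ h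
    (List.nodup_range.filter _) (by
      intro a ha b hb c hc hab hac nab nac nbc
      obtain ⟨a1, a2⟩ := hends a ha
      obtain ⟨b1, b2⟩ := hends b hb
      obtain ⟨c1, c2⟩ := hends c hc
      exact h3 _ _ _ hab hac (fun h => nab (hvs _ a1 _ b1 h)) (fun h => nac (hvs _ a1 _ c1 h))
        (fun h => nbc (hvs _ b1 _ c1 h)) a2 b2 c2)
  have hme : ∀ a < n, ((P.getD i 0).testBit a ^^ ((P.getD j 0).testBit a)) = true →
      a ∈ endsS n P i j := by
    intro a ha h
    simp only [endsS, List.mem_filter, List.mem_range]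
    exact ⟨ha, h⟩
  let T : Set V := {v | ∃ a < n, m.testBit a = true ∧ r (vs a) v}
  obtain ⟨ψ', hψ', hin, hout⟩ := hsw T (by
    rintro u v huv ⟨a, ha, hma, hau⟩
    exact ⟨a, ha, hma, hr.trans hau huv⟩)
  have hTin : ∀ v ∈ T, ∀ c, Equiv.swap (cs i) (cs j) c ∉ present K ψ v →
      c ∉ present K ψ' v := by
    rintro v hv c hc ⟨u, hu, huc⟩
    apply hc
    refine ⟨u, hu, ?_⟩
    rw [← huc, hin v u hu hv, Equiv.swap_apply_self]
  have hTout : ∀ v ∉ T, ∀ c, c ∉ present K ψ v → c ∉ present K ψ' v := by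
    rintro v hv c hc ⟨u, hu, huc⟩
    apply hc
    exact ⟨u, hu, by rw [← huc, hout v u hu hv]⟩
  refine ⟨m, hm, ψ', hψ', ?_⟩
  have hTm : ∀ a < n, ((P.getD i 0).testBit a ^^ ((P.getD j 0).testBit a)) = true →
      (vs a ∈ T ↔ m.testBit a = true) := by
    intro a ha hx
    constructor
    · rintro ⟨b, hb, hmb, hba⟩
      exact hcl b (hme b hb (hsub m hm b hb hmb)) a (hme a ha hx) hba hmb
    · intro h
      exact ⟨a, ha, h, hr.refl _⟩
  have hi' : i < P.length := hP ▸ hi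
  have hj' : j < P.length := hP ▸ hj
  have hgi : (flipS P i j m).getD i 0 = (P.getD i 0) ^^^ m := by
    simp [flipS, List.getD_eq_getElem?_getD, List.getElem?_set, hij.symm, hi']
  have hgj : (flipS P i j m).getD j 0 = (P.getD j 0) ^^^ m := by
    simp [flipS, List.getD_eq_getElem?_getD, List.getElem?_set, hj']
  have hgo : ∀ l, l ≠ i → l ≠ j → (flipS P i j m).getD l 0 = P.getD l 0 := by
    intro l h1 h2
    simp [flipS, List.getD_eq_getElem?_getD, List.getElem?_set, h1.symm, h2.symm]
  intro l hl a ha hb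
  have hl' : l < P.length := by simpa [flipS] using hl
  have Hi := hH i hi' a ha
  have Hj := hH j hj' a ha
  have S := hsub m hm a ha
  have X := hTm a ha
  by_cases hli : l = i
  · subst hli
    rw [hgi, Nat.testBit_xor] at hb
    by_cases hT : vs a ∈ T
    · apply hTin _ hT
      rw [Equiv.swap_apply_left]
      apply Hj
      revert hb S X
      cases (P.getD l 0).testBit a <;> cases (P.getD j 0).testBit a <;> cases m.testBit a <;>
        simp [hT]
    · apply hTout _ hT
      apply Hi
      revert hb S X
      cases (P.getD l 0).testBit a <;> cases (P.getD j 0).testBit a <;> cases m.testBit a <;>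
        simp [hT]
  by_cases hlj : l = j
  · subst hlj
    rw [hgj, Nat.testBit_xor] at hb
    by_cases hT : vs a ∈ T
    · apply hTin _ hT
      rw [Equiv.swap_apply_right]
      apply Hi
      revert hb S X
      cases (P.getD l 0).testBit a <;> cases (P.getD i 0).testBit a <;> cases m.testBit a <;>
        simp [hT]
    · apply hTout _ hT
      apply Hj
      revert hb S X
      cases (P.getD l 0).testBit a <;> cases (P.getD i 0).testBit a <;> cases m.testBit a <;>
        simp [hT]
  rw [hgo l hli hlj] at hb
  have hc := hH l hl' a ha hb
  by_cases hT : vs a ∈ T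
  · apply hTin _ hT
    rwa [Equiv.swap_apply_of_ne_of_ne]
    · exact fun h => hli (hcs _ (hP ▸ hl') _ hi h)
    · exact fun h => hlj (hcs _ (hP ▸ hl') _ hj h)
  · exact hTout _ hT _ hc

theorem run_sound (G K : SimpleGraph V) (k n N : ℕ) (vs : ℕ → V) (cs : ℕ → ℕ)
    (core : List (ℕ × ℕ))
    (hvs : ∀ a < n, ∀ b < n, vs a = vs b → a = b)
    (hcs : ∀ a < N, ∀ b < N, cs a = cs b → a = b)
    (hck : ∀ a < N, cs a ∈ Finset.Icc 1 k)
    (hcore : ∀ u v, G.Adj u v → K.Adj u v ∨ ∃ e ∈ core, s(u, v) = s(vs e.1, vs e.2))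
    (c : Cert) : ∀ (i j : ℕ) (P : List ℕ), P.length = N → runC n core c i j P = true →
      (c.isNode = true → ∀ ψ, IsEdgeColoring K k ψ → Holds n vs cs K ψ P →
        ∃ φ, IsEdgeColoring G k φ) ∧
      (∀ m ∈ c.masks, ∀ ψ, IsEdgeColoring K k ψ → Holds n vs cs K ψ (flipS P i j m) →
        ∃ φ, IsEdgeColoring G k φ) := by
  induction c with
  | fin f =>
    intro i j P hP h
    refine ⟨fun _ ψ hψ hH => ?_, by simp [Cert.masks]⟩
    exact fin_sound G K k n N vs cs core hvs hcs hck hcore f P hP (by simpa [runC] using h) ψ hψ hH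
  | swap i j l ih =>
    intro i' j' P hP h
    refine ⟨fun _ ψ hψ hH => ?_, by simp [Cert.masks]⟩
    simp only [runC, Bool.and_eq_true, bne_iff_ne, decide_eq_true_eq] at h
    obtain ⟨⟨⟨⟨⟨h1, h2⟩, h3⟩, h4⟩, h5⟩, h6⟩ := h
    obtain ⟨m, hm, ψ', hψ', hH'⟩ := swap_sound K k n N vs cs hvs hcs hck P l.masks hP i j h1
      (hP ▸ h2) (hP ▸ h3) h4 (by
        intro m hm a ha hma
        rw [List.all_eq_true] at h5
        have := h5 m hm
        rw [List.all_eq_true] at this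
        have := this a (List.mem_range.mpr ha)
        simpa [hma] using this) ψ hψ hH
    exact (ih i j P hP h6).2 m hm ψ' hψ' hH'
  | br m c r ihc ihr =>
    intro i j P hP h
    simp only [runC, Bool.and_eq_true] at h
    obtain ⟨⟨h1, h2⟩, h3⟩ := h
    refine ⟨by simp [Cert.isNode], ?_⟩
    intro m' hm' ψ hψ hH
    simp only [Cert.masks, List.mem_cons] at hm'
    rcases hm' with rfl | hm'
    · exact (ihc 0 0 _ (by simpa [flipS] using hP) h2).1 h1 ψ hψ hH
    · exact (ihr i j P hP h3).2 m' hm' ψ hψ hH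
  | nil =>
    intro i j P hP h
    exact ⟨by simp [Cert.isNode], by simp [Cert.masks]⟩

/-! ### Games in context -/

/-- The running context: `G` has no edge `k`-colouring, `G - xy ⊆ H` and `φ` colours `H`. -/
structure Ctx (G H : SimpleGraph V) (k : ℕ) (φ : V → V → ℕ) (x y : V) : Prop where
  nc : ¬ ∃ ψ, IsEdgeColoring G k ψ
  col : IsEdgeColoring H k φ
  sub : ∀ u v, G.Adj u v → H.Adj u v ∨ s(u, v) = s(x, y)

/-- Complete check of a certificate: `facts` are pairs (colour, vertex) with the colour missing,
`edges` are triples (colour, endpoint, endpoint). -/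
def gameOK (n : ℕ) (facts : List (ℕ × ℕ)) (edges : List (ℕ × ℕ × ℕ)) (P : List ℕ) (c : Cert) :
    Bool :=
  c.isNode && runC n ((0, 1) :: edges.map (fun e => e.2)) c 0 0 P &&
  (List.range P.length).all (fun i => (List.range n).all (fun a =>
    !(P.getD i 0).testBit a || facts.contains (i, a) ||
      edges.any (fun e => e.1 == i && (e.2.1 == a || e.2.2 == a))))

theorem game {G H : SimpleGraph V} {k : ℕ} {φ : V → V → ℕ} {x y : V} (C : Ctx G H k φ x y)
    (vl : List V) (cl : List ℕ) (hvl : (x :: y :: vl).Nodup) (hcl : cl.Nodup)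
    (hck : ∀ c ∈ cl, c ∈ Finset.Icc 1 k)
    (facts : List (ℕ × ℕ)) (edges : List (ℕ × ℕ × ℕ)) (P : List ℕ) (c : Cert)
    (hP : P.length = cl.length)
    (n : ℕ) (hn : (x :: y :: vl).length = n) (hok : gameOK n facts edges P c = true)
    (he : ∀ e ∈ edges, H.Adj ((x :: y :: vl).getD e.2.1 x) ((x :: y :: vl).getD e.2.2 x) ∧
      φ ((x :: y :: vl).getD e.2.1 x) ((x :: y :: vl).getD e.2.2 x) = cl.getD e.1 0)
    (hf : ∀ f ∈ facts, cl.getD f.1 0 ∉ present H φ ((x :: y :: vl).getD f.2 x)) : False := by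
  subst hn
  apply C.nc
  simp only [gameOK, Bool.and_eq_true] at hok
  obtain ⟨⟨h1, h2⟩, h3⟩ := hok
  set vs : ℕ → V := fun i => (x :: y :: vl).getD i x with hvs
  set cs : ℕ → ℕ := fun i => cl.getD i 0 with hcs
  let K : SimpleGraph V := H.deleteEdges {e | ∃ p ∈ edges, e = s(vs p.2.1, vs p.2.2)}
  obtain ⟨hs, hrg, hp⟩ := C.col
  have hKH : ∀ u v, K.Adj u v → H.Adj u v := fun u v h => (SimpleGraph.deleteEdges_adj.mp h).1
  have hψ : IsEdgeColoring K k φ :=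
    ⟨hs, fun u v h => hrg (hKH _ _ h), fun v a b h h' => hp (hKH _ _ h) (hKH _ _ h')⟩
  refine (run_sound G K k (x :: y :: vl).length cl.length vs cs _ ?_ ?_ ?_ ?_ c 0 0 P hP h2).1 h1
    φ hψ ?_
  · intro a ha b hb hab
    simp only [hvs] at hab
    rw [List.getD_eq_getElem _ _ ha, List.getD_eq_getElem _ _ hb] at hab
    exact (List.Nodup.getElem_inj_iff hvl).mp hab
  · intro a ha b hb hab
    simp only [hcs] at hab
    rw [List.getD_eq_getElem _ _ ha, List.getD_eq_getElem _ _ hb] at hab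
    exact (List.Nodup.getElem_inj_iff hcl).mp hab
  · intro a ha
    simp only [hcs]
    rw [List.getD_eq_getElem _ _ ha]
    exact hck _ (List.getElem_mem ha)
  · intro u v huv
    by_cases hK : K.Adj u v
    · exact Or.inl hK
    · right
      rcases C.sub u v huv with h | h
      · have : s(u, v) ∈ {e | ∃ p ∈ edges, e = s(vs p.2.1, vs p.2.2)} := by
          by_contra hn
          exact hK (SimpleGraph.deleteEdges_adj.mpr ⟨h, hn⟩)
        obtain ⟨p, hp, hpe⟩ := this
        exact ⟨p.2, by
          rw [List.mem_cons]; right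
          exact List.mem_map_of_mem hp, hpe⟩
      · exact ⟨(0, 1), by simp, by simpa [hvs] using h⟩
  · intro i hi a ha hb
    rw [List.all_eq_true] at h3
    have := h3 i (List.mem_range.mpr hi)
    rw [List.all_eq_true] at this
    have := this a (List.mem_range.mpr ha)
    simp only [hb, Bool.not_true, Bool.false_or, Bool.or_eq_true, List.contains_iff_mem,
      List.any_eq_true, Bool.and_eq_true, beq_iff_eq] at this
    rintro ⟨u, hu, huc⟩
    have hu' := SimpleGraph.deleteEdges_adj.mp hu
    rcases this with h | ⟨e, hee, rfl, h⟩
    · exact hf _ h ⟨u, hu'.1, huc⟩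
    · obtain ⟨e1, e2⟩ := he e hee
      rcases h with rfl | rfl
      · apply hu'.2
        refine ⟨e, hee, ?_⟩
        by_contra hne
        refine hp hu'.1 e1 ?_ (huc.trans e2.symm)
        rintro rfl
        exact hne rfl
      · apply hu'.2
        refine ⟨e, hee, ?_⟩
        by_contra hne
        rw [hs] at e2
        refine hp hu'.1 e1.symm ?_ (huc.trans e2.symm)
        rintro rfl
        exact hne Sym2.eq_swap

/-! ### The certificates -/

theorem g_P1_x {G H : SimpleGraph V} {k : ℕ} {φ : V → V → ℕ} {x y z : V}
    {γ α : ℕ} (C : Ctx G H k φ x y)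
    (hv : [x, y, z].Nodup) (hc : [γ, α].Nodup)
    (hk : ∀ c ∈ [γ, α], c ∈ Finset.Icc 1 k)
    (e0 : H.Adj x z) (c0 : φ x z = γ) (f0 : γ ∉ present H φ y) (f1 : α ∉ present H φ x)
    (f2 : α ∉ present H φ z) : False := by
  refine game C [z] [γ, α] hv hc hk
    [(0, 1), (1, 0), (1, 2)]
    [(0, 0, 2)]
    [7, 5]
    (.fin [0, 1])
    rfl 3 rfl (by decide +kernel) ?_ ?_
  · simp [e0, c0]
  · simp [f0, f1, f2]

theorem g_P1_xv {G H : SimpleGraph V} {k : ℕ} {φ : V → V → ℕ} {x y z v : V}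
    {γ α η₁ η₂ : ℕ} (C : Ctx G H k φ x y)
    (hv : [x, y, z, v].Nodup) (hc : [γ, α, η₁, η₂].Nodup)
    (hk : ∀ c ∈ [γ, α, η₁, η₂], c ∈ Finset.Icc 1 k)
    (e0 : H.Adj x z) (c0 : φ x z = γ) (e1 : H.Adj z v) (c1 : φ z v = α) (f0 : γ ∉ present H φ y)
    (f1 : α ∉ present H φ x) (f2 : η₁ ∉ present H φ x) (f3 : η₁ ∉ present H φ v)
    (f4 : η₂ ∉ present H φ x) (f5 : η₂ ∉ present H φ v) : False := by
  refine game C [z, v] [γ, α, η₁, η₂] hv hc hk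
    [(0, 1), (1, 0), (2, 0), (2, 3), (3, 0), (3, 3)]
    [(0, 0, 2), (1, 2, 3)]
    [7, 13, 9, 9]
    (.swap 0 2 (.br 6 (.fin [2, 1, 2]) (.br 10 (.fin [2, 0, 1]) (.br 2 (.fin [2, 0, 1]) (.nil)))))
    rfl 4 rfl (by decide +kernel) ?_ ?_
  · simp [e0, c0, e1, c1]
  · simp [f0, f1, f2, f3, f4, f5]

theorem g_P1_y {G H : SimpleGraph V} {k : ℕ} {φ : V → V → ℕ} {x y z : V}
    {γ α η₁ : ℕ} (C : Ctx G H k φ x y)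
    (hv : [x, y, z].Nodup) (hc : [γ, α, η₁].Nodup)
    (hk : ∀ c ∈ [γ, α, η₁], c ∈ Finset.Icc 1 k)
    (e0 : H.Adj x z) (c0 : φ x z = γ) (f0 : γ ∉ present H φ y) (f1 : α ∉ present H φ y)
    (f2 : α ∉ present H φ z) (f3 : η₁ ∉ present H φ x) : False := by
  refine game C [z] [γ, α, η₁] hv hc hk
    [(0, 1), (1, 1), (1, 2), (2, 0)]
    [(0, 0, 2)]
    [7, 6, 1]
    (.swap 2 1 (.br 3 (.fin [0, 1]) (.br 5 (.fin [1, 0]) (.br 1 (.fin [0, 1]) (.nil)))))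
    rfl 3 rfl (by decide +kernel) ?_ ?_
  · simp [e0, c0]
  · simp [f0, f1, f2, f3]

theorem g_P1_yv {G H : SimpleGraph V} {k : ℕ} {φ : V → V → ℕ} {x y z v : V}
    {γ α η₁ η₂ : ℕ} (C : Ctx G H k φ x y)
    (hv : [x, y, z, v].Nodup) (hc : [γ, α, η₁, η₂].Nodup)
    (hk : ∀ c ∈ [γ, α, η₁, η₂], c ∈ Finset.Icc 1 k)
    (e0 : H.Adj x z) (c0 : φ x z = γ) (e1 : H.Adj z v) (c1 : φ z v = α) (f0 : γ ∉ present H φ y)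
    (f1 : α ∉ present H φ y) (f2 : η₁ ∉ present H φ x) (f3 : η₁ ∉ present H φ v)
    (f4 : η₂ ∉ present H φ x) (f5 : η₂ ∉ present H φ v) : False := by
  refine game C [z, v] [γ, α, η₁, η₂] hv hc hk
    [(0, 1), (1, 1), (2, 0), (2, 3), (3, 0), (3, 3)]
    [(0, 0, 2), (1, 2, 3)]
    [7, 14, 9, 9]
    (.swap 0 2 (.br 6 (.swap 3 1 (.br 3 (.fin [2, 1, 2]) (.br 5 (.fin [1, 2, 3]) (.br 1 (.fin [1,
      2, 1]) (.nil))))) (.br 10 (.fin [2, 0, 1]) (.br 2 (.fin [2, 0, 1]) (.nil)))))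
    rfl 4 rfl (by decide +kernel) ?_ ?_
  · simp [e0, c0, e1, c1]
  · simp [f0, f1, f2, f3, f4, f5]

theorem g_P1_u {G H : SimpleGraph V} {k : ℕ} {φ : V → V → ℕ} {x y z u : V}
    {γ α η₁ η₂ : ℕ} (C : Ctx G H k φ x y)
    (hv : [x, y, z, u].Nodup) (hc : [γ, α, η₁, η₂].Nodup)
    (hk : ∀ c ∈ [γ, α, η₁, η₂], c ∈ Finset.Icc 1 k)
    (e0 : H.Adj x z) (c0 : φ x z = γ) (e1 : H.Adj y u) (c1 : φ y u = α) (f0 : γ ∉ present H φ y)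
    (f1 : α ∉ present H φ z) (f2 : η₁ ∉ present H φ x) (f3 : η₁ ∉ present H φ u)
    (f4 : η₂ ∉ present H φ x) (f5 : η₂ ∉ present H φ u) : False := by
  refine game C [z, u] [γ, α, η₁, η₂] hv hc hk
    [(0, 1), (1, 2), (2, 0), (2, 3), (3, 0), (3, 3)]
    [(0, 0, 2), (1, 1, 3)]
    [7, 14, 9, 9]
    (.swap 0 2 (.br 6 (.swap 3 1 (.br 3 (.fin [2, 1, 3]) (.br 5 (.fin [1, 2, 2]) (.br 1 (.fin [1,
      2, 2]) (.nil))))) (.br 10 (.fin [2, 0, 1]) (.br 2 (.fin [2, 0, 1]) (.nil)))))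
    rfl 4 rfl (by decide +kernel) ?_ ?_
  · simp [e0, c0, e1, c1]
  · simp [f0, f1, f2, f3, f4, f5]

theorem g_P1_uv {G H : SimpleGraph V} {k : ℕ} {φ : V → V → ℕ} {x y z u v : V}
    {γ α η₁ η₂ : ℕ} (C : Ctx G H k φ x y)
    (hv : [x, y, z, u, v].Nodup) (hc : [γ, α, η₁, η₂].Nodup)
    (hk : ∀ c ∈ [γ, α, η₁, η₂], c ∈ Finset.Icc 1 k)
    (e0 : H.Adj x z) (c0 : φ x z = γ) (e1 : H.Adj y u) (c1 : φ y u = α)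
    (e2 : H.Adj z v) (c2 : φ z v = α) (f0 : γ ∉ present H φ y) (f1 : η₁ ∉ present H φ x)
    (f2 : η₁ ∉ present H φ u) (f3 : η₂ ∉ present H φ x) (f4 : η₂ ∉ present H φ v) : False := by
  refine game C [z, u, v] [γ, α, η₁, η₂] hv hc hk
    [(0, 1), (2, 0), (2, 3), (3, 0), (3, 4)]
    [(0, 0, 2), (1, 1, 3), (1, 2, 4)]
    [7, 30, 9, 17]
    (.swap 0 1 (.br 9 (.swap 2 0 (.br 3 (.fin [1, 0, 2, 1]) (.br 5 (.swap 2 3 (.br 5 (.swap 2 1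
      (.br 6 (.fin [0, 2, 2, 3]) (.br 10 (.fin [2, 1, 0, 3]) (.br 18 (.fin [0, 1, 2, 3])
      (.nil))))) (.br 9 (.fin [1, 2, 0, 1]) (.br 17 (.fin [1, 2, 0, 1]) (.nil))))) (.br 1 (.fin
      [1, 0, 0, 1]) (.nil))))) (.br 17 (.swap 3 0 (.br 3 (.swap 2 3 (.br 3 (.swap 1 3 (.br 6
      (.fin [3, 0, 2, 3]) (.br 10 (.fin [3, 1, 2, 0]) (.br 18 (.fin [3, 0, 2, 1]) (.nil))))) (.br
      9 (.fin [3, 1, 1, 0]) (.br 17 (.fin [3, 1, 1, 0]) (.nil))))) (.br 5 (.fin [0, 1, 1, 3])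
      (.br 1 (.fin [0, 1, 1, 0]) (.nil))))) (.br 1 (.swap 0 2 (.br 3 (.fin [1, 0, 2, 1]) (.br 5
      (.swap 2 3 (.br 5 (.fin [0, 1, 1, 3]) (.br 9 (.fin [0, 2, 1, 1]) (.br 17 (.fin [0, 1, 1,
      2]) (.nil))))) (.br 9 (.fin [1, 0, 0, 1]) (.nil))))) (.nil)))))
    rfl 5 rfl (by decide +kernel) ?_ ?_
  · simp [e0, c0, e1, c1, e2, c2]
  · simp [f0, f1, f2, f3, f4]

theorem g_P1A_y {G H : SimpleGraph V} {k : ℕ} {φ : V → V → ℕ} {x y z w : V}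
    {γ α η₁ η₂ : ℕ} (C : Ctx G H k φ x y)
    (hv : [x, y, z, w].Nodup) (hc : [γ, α, η₁, η₂].Nodup)
    (hk : ∀ c ∈ [γ, α, η₁, η₂], c ∈ Finset.Icc 1 k)
    (e0 : H.Adj x z) (c0 : φ x z = γ) (e1 : H.Adj y w) (c1 : φ y w = γ) (f0 : α ∉ present H φ y)
    (f1 : α ∉ present H φ z) (f2 : η₁ ∉ present H φ x) (f3 : η₁ ∉ present H φ w)
    (f4 : η₂ ∉ present H φ x) (f5 : η₂ ∉ present H φ w) : False := by
  refine game C [z, w] [γ, α, η₁, η₂] hv hc hk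
    [(1, 1), (1, 2), (2, 0), (2, 3), (3, 0), (3, 3)]
    [(0, 0, 2), (0, 1, 3)]
    [15, 6, 9, 9]
    (.swap 1 2 (.br 3 (.fin [0, 1, 2]) (.br 5 (.fin [1, 0, 0]) (.br 9 (.fin [0, 1, 1]) (.nil)))))
    rfl 4 rfl (by decide +kernel) ?_ ?_
  · simp [e0, c0, e1, c1]
  · simp [f0, f1, f2, f3, f4, f5]

theorem g_P1A_yv {G H : SimpleGraph V} {k : ℕ} {φ : V → V → ℕ} {x y z v w : V}
    {γ α η₁ η₂ : ℕ} (C : Ctx G H k φ x y)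
    (hv : [x, y, z, v, w].Nodup) (hc : [γ, α, η₁, η₂].Nodup)
    (hk : ∀ c ∈ [γ, α, η₁, η₂], c ∈ Finset.Icc 1 k)
    (e0 : H.Adj x z) (c0 : φ x z = γ) (e1 : H.Adj z v) (c1 : φ z v = α)
    (e2 : H.Adj y w) (c2 : φ y w = γ) (f0 : α ∉ present H φ y) (f1 : η₁ ∉ present H φ x)
    (f2 : η₁ ∉ present H φ v) (f3 : η₂ ∉ present H φ x) (f4 : η₂ ∉ present H φ w) : False := by
  refine game C [z, v, w] [γ, α, η₁, η₂] hv hc hk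
    [(1, 1), (2, 0), (2, 3), (3, 0), (3, 4)]
    [(0, 0, 2), (1, 2, 3), (0, 1, 4)]
    [23, 14, 9, 17]
    (.swap 2 1 (.br 3 (.swap 2 3 (.br 3 (.swap 2 0 (.br 6 (.fin [2, 1, 2, 3]) (.br 10 (.fin [2, 0,
      1, 3]) (.br 18 (.fin [2, 0, 1, 3]) (.nil))))) (.br 9 (.fin [2, 0, 1, 0]) (.br 17 (.fin [2,
      0, 1, 0]) (.nil))))) (.br 5 (.fin [1, 0, 2, 0]) (.br 1 (.fin [1, 0, 1, 0]) (.nil)))))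
    rfl 5 rfl (by decide +kernel) ?_ ?_
  · simp [e0, c0, e1, c1, e2, c2]
  · simp [f0, f1, f2, f3, f4]

theorem g_P1A_yw {G H : SimpleGraph V} {k : ℕ} {φ : V → V → ℕ} {x y z w : V}
    {γ α η₁ η₂ : ℕ} (C : Ctx G H k φ x y)
    (hv : [x, y, z, w].Nodup) (hc : [γ, α, η₁, η₂].Nodup)
    (hk : ∀ c ∈ [γ, α, η₁, η₂], c ∈ Finset.Icc 1 k)
    (e0 : H.Adj x z) (c0 : φ x z = γ) (e1 : H.Adj z w) (c1 : φ z w = α)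
    (e2 : H.Adj y w) (c2 : φ y w = γ) (f0 : α ∉ present H φ y) (f1 : η₁ ∉ present H φ x)
    (f2 : η₁ ∉ present H φ w) (f3 : η₂ ∉ present H φ x) (f4 : η₂ ∉ present H φ w) : False := by
  refine game C [z, w] [γ, α, η₁, η₂] hv hc hk
    [(1, 1), (2, 0), (2, 3), (3, 0), (3, 3)]
    [(0, 0, 2), (1, 2, 3), (0, 1, 3)]
    [15, 14, 9, 9]
    (.swap 2 1 (.br 3 (.fin [0, 1, 0, 2]) (.br 5 (.fin [1, 0, 2, 0]) (.br 1 (.fin [0, 1, 0, 1])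
      (.nil)))))
    rfl 4 rfl (by decide +kernel) ?_ ?_
  · simp [e0, c0, e1, c1, e2, c2]
  · simp [f0, f1, f2, f3, f4]

theorem g_small_zA {G H : SimpleGraph V} {k : ℕ} {φ : V → V → ℕ} {x y z w : V}
    {γ η₁ η₂ η₃ : ℕ} (C : Ctx G H k φ x y)
    (hv : [x, y, z, w].Nodup) (hc : [γ, η₁, η₂, η₃].Nodup)
    (hk : ∀ c ∈ [γ, η₁, η₂, η₃], c ∈ Finset.Icc 1 k)
    (e0 : H.Adj x z) (c0 : φ x z = γ) (e1 : H.Adj y w) (c1 : φ y w = γ) (f0 : η₁ ∉ present H φ y)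
    (f1 : η₂ ∉ present H φ x) (f2 : η₂ ∉ present H φ z) (f3 : η₃ ∉ present H φ x)
    (f4 : η₃ ∉ present H φ w) : False := by
  refine game C [z, w] [γ, η₁, η₂, η₃] hv hc hk
    [(1, 1), (2, 0), (2, 2), (3, 0), (3, 3)]
    [(0, 0, 2), (0, 1, 3)]
    [15, 2, 5, 9]
    (.swap 1 3 (.br 3 (.fin [0, 2, 3]) (.br 9 (.fin [0, 2, 1]) (.br 1 (.fin [1, 0, 0]) (.nil)))))
    rfl 4 rfl (by decide +kernel) ?_ ?_
  · simp [e0, c0, e1, c1]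
  · simp [f0, f1, f2, f3, f4]

theorem g_2a_vv {G H : SimpleGraph V} {k : ℕ} {φ : V → V → ℕ} {x y z c v w : V}
    {γ β α η₁ η₂ : ℕ} (C : Ctx G H k φ x y)
    (hv : [x, y, z, c, v, w].Nodup) (hc : [γ, β, α, η₁, η₂].Nodup)
    (hk : ∀ c ∈ [γ, β, α, η₁, η₂], c ∈ Finset.Icc 1 k)
    (e0 : H.Adj x z) (c0 : φ x z = γ) (e1 : H.Adj x c) (c1 : φ x c = β)
    (e2 : H.Adj z v) (c2 : φ z v = α) (e3 : H.Adj c w) (c3 : φ c w = α) (f0 : γ ∉ present H φ y)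
    (f1 : β ∉ present H φ y) (f2 : η₁ ∉ present H φ x) (f3 : η₁ ∉ present H φ v)
    (f4 : η₂ ∉ present H φ x) (f5 : η₂ ∉ present H φ w) : False := by
  refine game C [z, c, v, w] [γ, β, α, η₁, η₂] hv hc hk
    [(0, 1), (1, 1), (3, 0), (3, 4), (4, 0), (4, 5)]
    [(0, 0, 2), (1, 0, 3), (2, 2, 4), (2, 3, 5)]
    [7, 11, 60, 17, 33]
    (.swap 0 2 (.br 3 (.swap 0 3 (.br 5 (.swap 4 2 (.br 6 (.swap 0 4 (.br 6 (.swap 1 4 (.br 10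
      (.fin [4, 0, 2, 3, 4]) (.br 34 (.fin [4, 0, 1, 3, 2]) (.br 2 (.fin [4, 0, 1, 3, 2])
      (.nil))))) (.br 34 (.fin [0, 4, 1, 3, 2]) (.br 2 (.fin [0, 4, 1, 3, 2]) (.nil))))) (.br 10
      (.fin [4, 2, 1, 3, 4]) (.br 18 (.fin [4, 2, 1, 3, 2]) (.nil))))) (.br 17 (.fin [2, 0, 1, 2,
      2]) (.br 1 (.fin [2, 0, 1, 2, 2]) (.nil))))) (.br 18 (.swap 4 2 (.br 3 (.swap 1 3 (.br 10
      (.swap 1 4 (.br 3 (.swap 3 4 (.br 10 (.swap 3 2 (.br 12 (.fin [4, 0, 3, 3, 4]) (.br 20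
      (.fin [4, 3, 2, 0, 4]) (.br 36 (.fin [4, 0, 2, 3, 4]) (.nil))))) (.br 18 (.fin [4, 2, 3, 0,
      2]) (.br 34 (.fin [4, 2, 3, 0, 2]) (.nil))))) (.br 33 (.fin [4, 2, 3, 0, 2]) (.br 1 (.fin
      [4, 2, 3, 0, 2]) (.nil))))) (.br 18 (.fin [3, 2, 1, 0, 2]) (.br 2 (.fin [3, 2, 1, 0, 2])
      (.nil))))) (.br 5 (.swap 1 4 (.br 12 (.swap 1 3 (.br 6 (.fin [3, 0, 2, 3, 4]) (.br 18 (.fin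
      [3, 0, 2, 1, 4]) (.br 2 (.fin [3, 1, 2, 0, 4]) (.nil))))) (.br 36 (.swap 3 1 (.br 6 (.fin
      [2, 0, 1, 3, 2]) (.br 10 (.fin [2, 1, 3, 0, 2]) (.br 18 (.fin [2, 0, 1, 1, 2]) (.br 12
      (.fin [1, 0, 3, 3, 2]) (.br 20 (.fin [1, 3, 2, 0, 1]) (.br 4 (.fin [1, 0, 2, 3, 1]) (.br 2
      (.fin [3, 1, 2, 0, 1]) (.nil))))))))) (.br 4 (.swap 1 3 (.br 6 (.fin [2, 0, 1, 3, 2]) (.br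
      10 (.fin [2, 1, 3, 0, 2]) (.br 18 (.fin [2, 0, 1, 1, 2]) (.nil))))) (.br 5 (.swap 1 3 (.br
      12 (.fin [2, 0, 3, 3, 2]) (.br 20 (.swap 1 4 (.br 3 (.fin [2, 3, 1, 0, 2]) (.br 9 (.fin [1,
      3, 2, 0, 4]) (.br 17 (.fin [2, 3, 1, 0, 2]) (.br 33 (.fin [1, 3, 2, 0, 1]) (.br 1 (.fin [2,
      3, 1, 0, 2]) (.nil))))))) (.br 4 (.swap 1 4 (.br 3 (.fin [2, 0, 1, 3, 2]) (.br 9 (.fin [1,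
      0, 2, 3, 4]) (.br 33 (.fin [1, 0, 2, 3, 1]) (.nil))))) (.br 5 (.fin [2, 0, 1, 3, 2]) (.br 6
      (.swap 1 4 (.br 9 (.fin [3, 0, 2, 3, 4]) (.br 33 (.fin [2, 0, 1, 3, 2]) (.br 1 (.fin [2, 0,
      1, 3, 2]) (.nil))))) (.br 18 (.swap 3 1 (.br 3 (.fin [2, 0, 1, 1, 2]) (.br 10 (.fin [2, 0,
      3, 1, 2]) (.br 23 (.fin [2, 0, 1, 3, 2]) (.br 2 (.swap 1 4 (.br 3 (.fin [2, 0, 1, 1, 2])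
      (.br 10 (.fin [2, 0, 4, 1, 2]) (.br 23 (.fin [2, 0, 1, 4, 2]) (.br 34 (.fin [4, 0, 2, 1,
      1]) (.br 9 (.fin [1, 0, 2, 1, 4]) (.br 33 (.fin [1, 0, 2, 1, 1]) (.nil)))))))) (.br 9
      (.swap 3 4 (.br 3 (.fin [2, 0, 3, 1, 2]) (.br 9 (.fin [3, 0, 2, 1, 4]) (.br 33 (.fin [2, 0,
      3, 1, 2]) (.nil))))) (.br 6 (.swap 1 4 (.br 3 (.fin [2, 3, 1, 0, 2]) (.br 9 (.fin [1, 3, 2,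
      0, 4]) (.br 17 (.fin [2, 3, 1, 0, 2]) (.br 33 (.fin [1, 3, 2, 0, 1]) (.br 1 (.fin [2, 3, 1,
      0, 2]) (.nil))))))) (.br 1 (.fin [2, 0, 1, 1, 2]) (.nil))))))))) (.br 11 (.swap 3 4 (.br 3
      (.fin [2, 1, 3, 0, 2]) (.br 9 (.fin [3, 1, 2, 0, 4]) (.br 17 (.fin [2, 1, 3, 0, 2]) (.br 33
      (.fin [2, 1, 3, 0, 2]) (.br 1 (.fin [2, 1, 3, 0, 2]) (.nil))))))) (.br 17 (.fin [2, 0, 1,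
      1, 2]) (.br 1 (.swap 1 4 (.br 6 (.fin [2, 4, 1, 0, 2]) (.br 10 (.fin [2, 1, 4, 0, 2]) (.br
      34 (.fin [4, 1, 2, 0, 1]) (.nil))))) (.nil))))))))))) (.br 9 (.swap 3 4 (.br 12 (.fin [2,
      0, 3, 3, 2]) (.br 20 (.fin [2, 3, 4, 0, 2]) (.br 36 (.fin [2, 0, 4, 3, 2]) (.nil))))) (.br
      6 (.swap 1 3 (.br 12 (.fin [2, 0, 3, 3, 2]) (.br 20 (.fin [2, 3, 1, 0, 2]) (.br 4 (.fin [2,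
      0, 1, 3, 2]) (.nil))))) (.br 43 (.swap 4 3 (.br 6 (.fin [2, 0, 4, 3, 2]) (.br 10 (.fin [2,
      4, 3, 0, 2]) (.br 18 (.fin [2, 0, 4, 4, 2]) (.nil))))) (.br 2 (.swap 3 4 (.br 3 (.fin [2,
      4, 1, 0, 2]) (.br 5 (.fin [2, 0, 1, 3, 2]) (.br 17 (.fin [2, 0, 1, 4, 2]) (.br 33 (.fin [2,
      4, 1, 0, 2]) (.br 1 (.fin [2, 4, 1, 0, 2]) (.nil))))))) (.br 11 (.swap 3 4 (.br 6 (.fin [2,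
      0, 4, 3, 2]) (.br 10 (.fin [2, 4, 3, 0, 2]) (.br 18 (.fin [2, 0, 4, 4, 2]) (.br 12 (.fin
      [2, 0, 3, 3, 2]) (.br 20 (.fin [2, 3, 4, 0, 2]) (.br 4 (.fin [2, 0, 4, 3, 2]) (.br 2 (.fin
      [3, 4, 2, 0, 4]) (.nil))))))))) (.br 34 (.swap 4 3 (.br 3 (.fin [2, 4, 1, 0, 2]) (.br 5
      (.fin [2, 0, 1, 3, 2]) (.br 17 (.fin [2, 0, 1, 4, 2]) (.nil))))) (.nil)))))))))))) (.br 9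
      (.swap 3 2 (.br 6 (.fin [3, 0, 1, 3, 4]) (.br 18 (.fin [3, 0, 1, 2, 4]) (.br 34 (.fin [3,
      2, 1, 0, 4]) (.nil))))) (.nil))))) (.br 43 (.swap 4 0 (.br 5 (.swap 3 4 (.br 5 (.swap 1 4
      (.br 10 (.fin [4, 2, 0, 3, 4]) (.br 34 (.fin [4, 2, 0, 3, 1]) (.br 2 (.fin [4, 2, 1, 3, 0])
      (.nil))))) (.br 17 (.fin [2, 4, 1, 2, 0]) (.br 33 (.fin [2, 4, 1, 2, 0]) (.nil))))) (.br 9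
      (.fin [2, 0, 1, 2, 4]) (.br 1 (.fin [2, 0, 1, 2, 0]) (.nil))))) (.br 2 (.swap 4 2 (.br 3
      (.swap 3 4 (.br 3 (.swap 1 4 (.br 10 (.fin [4, 0, 2, 2, 4]) (.br 34 (.fin [4, 0, 1, 2, 2])
      (.br 2 (.fin [4, 0, 1, 2, 2]) (.nil))))) (.br 17 (.fin [4, 0, 1, 2, 2]) (.br 33 (.fin [4,
      0, 1, 2, 2]) (.nil))))) (.br 10 (.fin [4, 0, 1, 2, 4]) (.br 23 (.swap 3 4 (.br 3 (.swap 1 4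
      (.br 30 (.fin [4, 0, 2, 1, 4]) (.br 40 (.fin [1, 0, 4, 4, 2]) (.br 8 (.fin [1, 0, 2, 4, 4])
      (.br 10 (.fin [4, 0, 2, 4, 4]) (.br 54 (.fin [4, 0, 1, 1, 2]) (.br 22 (.fin [4, 0, 1, 1,
      2]) (.br 34 (.fin [4, 0, 1, 4, 2]) (.br 2 (.fin [4, 0, 1, 4, 2]) (.nil)))))))))) (.br 5
      (.fin [4, 0, 1, 3, 2]) (.br 33 (.fin [4, 0, 1, 4, 2]) (.nil))))) (.br 2 (.fin [4, 0, 1, 2,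
      2]) (.br 9 (.fin [2, 0, 1, 2, 4]) (.br 1 (.fin [2, 0, 1, 2, 2]) (.nil)))))))) (.br 17
      (.swap 1 4 (.br 10 (.swap 3 0 (.br 3 (.swap 1 3 (.br 3 (.swap 3 2 (.br 12 (.fin [4, 0, 3,
      3, 4]) (.br 20 (.fin [4, 3, 2, 0, 4]) (.br 36 (.fin [4, 0, 2, 3, 4]) (.nil))))) (.br 17
      (.fin [3, 2, 4, 0, 2]) (.br 1 (.fin [3, 2, 4, 0, 2]) (.nil))))) (.br 5 (.fin [0, 2, 4, 3,
      2]) (.br 1 (.fin [0, 2, 4, 0, 2]) (.nil))))) (.br 34 (.fin [4, 2, 1, 0, 2]) (.br 2 (.fin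
      [4, 2, 1, 0, 2]) (.nil))))) (.br 1 (.swap 0 3 (.br 3 (.swap 1 4 (.br 10 (.fin [4, 0, 2, 2,
      4]) (.br 34 (.fin [4, 0, 1, 2, 2]) (.br 2 (.fin [4, 0, 1, 2, 2]) (.nil))))) (.br 5 (.fin
      [0, 2, 1, 3, 2]) (.br 17 (.fin [0, 2, 1, 0, 2]) (.nil))))) (.nil))))))))
    rfl 6 rfl (by decide +kernel) ?_ ?_
  · simp [e0, c0, e1, c1, e2, c2, e3, c3]
  · simp [f0, f1, f2, f3, f4, f5]

theorem g_2a_nv {G H : SimpleGraph V} {k : ℕ} {φ : V → V → ℕ} {x y z c w : V}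
    {γ β α η₁ η₂ : ℕ} (C : Ctx G H k φ x y)
    (hv : [x, y, z, c, w].Nodup) (hc : [γ, β, α, η₁, η₂].Nodup)
    (hk : ∀ c ∈ [γ, β, α, η₁, η₂], c ∈ Finset.Icc 1 k)
    (e0 : H.Adj x z) (c0 : φ x z = γ) (e1 : H.Adj x c) (c1 : φ x c = β)
    (e2 : H.Adj c w) (c2 : φ c w = α) (f0 : γ ∉ present H φ y) (f1 : β ∉ present H φ y)
    (f2 : α ∉ present H φ z) (f3 : η₁ ∉ present H φ x) (f4 : η₁ ∉ present H φ w)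
    (f5 : η₂ ∉ present H φ x) (f6 : η₂ ∉ present H φ w) : False := by
  refine game C [z, c, w] [γ, β, α, η₁, η₂] hv hc hk
    [(0, 1), (1, 1), (2, 2), (3, 0), (3, 4), (4, 0), (4, 4)]
    [(0, 0, 2), (1, 0, 3), (2, 3, 4)]
    [7, 11, 28, 17, 17]
    (.swap 1 3 (.br 10 (.swap 4 2 (.br 5 (.fin [3, 0, 2, 3]) (.br 9 (.fin [0, 2, 3, 4]) (.br 1
      (.fin [0, 2, 3, 2]) (.nil))))) (.br 18 (.fin [3, 0, 1, 2]) (.br 2 (.fin [3, 0, 1, 2])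
      (.nil)))))
    rfl 5 rfl (by decide +kernel) ?_ ?_
  · simp [e0, c0, e1, c1, e2, c2]
  · simp [f0, f1, f2, f3, f4, f5, f6]

theorem g_2a_nn {G H : SimpleGraph V} {k : ℕ} {φ : V → V → ℕ} {x y z c : V}
    {γ β α η₁ : ℕ} (C : Ctx G H k φ x y)
    (hv : [x, y, z, c].Nodup) (hc : [γ, β, α, η₁].Nodup)
    (hk : ∀ c ∈ [γ, β, α, η₁], c ∈ Finset.Icc 1 k)
    (e0 : H.Adj x z) (c0 : φ x z = γ) (e1 : H.Adj x c) (c1 : φ x c = β) (f0 : γ ∉ present H φ y)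
    (f1 : β ∉ present H φ y) (f2 : α ∉ present H φ z) (f3 : α ∉ present H φ c)
    (f4 : η₁ ∉ present H φ x) : False := by
  refine game C [z, c] [γ, β, α, η₁] hv hc hk
    [(0, 1), (1, 1), (2, 2), (2, 3), (3, 0)]
    [(0, 0, 2), (1, 0, 3)]
    [7, 11, 12, 1]
    (.swap 3 2 (.br 5 (.fin [1, 0, 2]) (.br 9 (.fin [0, 2, 1]) (.br 1 (.fin [0, 2, 1]) (.nil)))))
    rfl 4 rfl (by decide +kernel) ?_ ?_
  · simp [e0, c0, e1, c1]
  · simp [f0, f1, f2, f3, f4]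

theorem g_2b_nn {G H : SimpleGraph V} {k : ℕ} {φ : V → V → ℕ} {x y z c u : V}
    {γ β α η₁ η₂ : ℕ} (C : Ctx G H k φ x y)
    (hv : [x, y, z, c, u].Nodup) (hc : [γ, β, α, η₁, η₂].Nodup)
    (hk : ∀ c ∈ [γ, β, α, η₁, η₂], c ∈ Finset.Icc 1 k)
    (e0 : H.Adj x z) (c0 : φ x z = γ) (e1 : H.Adj x c) (c1 : φ x c = β)
    (e2 : H.Adj y u) (c2 : φ y u = β) (f0 : γ ∉ present H φ y) (f1 : α ∉ present H φ z)
    (f2 : α ∉ present H φ c) (f3 : η₁ ∉ present H φ x) (f4 : η₁ ∉ present H φ u)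
    (f5 : η₂ ∉ present H φ x) (f6 : η₂ ∉ present H φ u) : False := by
  refine game C [z, c, u] [γ, β, α, η₁, η₂] hv hc hk
    [(0, 1), (2, 2), (2, 3), (3, 0), (3, 4), (4, 0), (4, 4)]
    [(0, 0, 2), (1, 0, 3), (1, 1, 4)]
    [7, 27, 12, 17, 17]
    (.swap 0 2 (.br 3 (.swap 2 3 (.br 6 (.fin [1, 3, 2, 3]) (.br 10 (.fin [1, 2, 3, 3]) (.br 18
      (.fin [3, 2, 1, 1]) (.nil))))) (.br 9 (.swap 0 3 (.br 3 (.fin [1, 2, 0, 3]) (.br 5 (.fin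
      [0, 2, 1, 1]) (.br 9 (.fin [0, 2, 1, 1]) (.br 17 (.fin [0, 2, 1, 1]) (.br 1 (.fin [0, 2, 1,
      1]) (.nil))))))) (.br 1 (.swap 0 3 (.br 3 (.fin [1, 0, 2, 3]) (.br 5 (.fin [0, 2, 1, 1])
      (.br 17 (.fin [0, 2, 1, 1]) (.nil))))) (.nil)))))
    rfl 5 rfl (by decide +kernel) ?_ ?_
  · simp [e0, c0, e1, c1, e2, c2]
  · simp [f0, f1, f2, f3, f4, f5, f6]

theorem g_2b_nw {G H : SimpleGraph V} {k : ℕ} {φ : V → V → ℕ} {x y z c w u : V}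
    {γ β α η₁ η₂ : ℕ} (C : Ctx G H k φ x y)
    (hv : [x, y, z, c, w, u].Nodup) (hc : [γ, β, α, η₁, η₂].Nodup)
    (hk : ∀ c ∈ [γ, β, α, η₁, η₂], c ∈ Finset.Icc 1 k)
    (e0 : H.Adj x z) (c0 : φ x z = γ) (e1 : H.Adj x c) (c1 : φ x c = β)
    (e2 : H.Adj c w) (c2 : φ c w = α) (e3 : H.Adj y u) (c3 : φ y u = β) (f0 : γ ∉ present H φ y)
    (f1 : α ∉ present H φ z) (f2 : η₁ ∉ present H φ x) (f3 : η₁ ∉ present H φ w)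
    (f4 : η₂ ∉ present H φ x) (f5 : η₂ ∉ present H φ u) : False := by
  refine game C [z, c, w, u] [γ, β, α, η₁, η₂] hv hc hk
    [(0, 1), (2, 2), (3, 0), (3, 4), (4, 0), (4, 5)]
    [(0, 0, 2), (1, 0, 3), (2, 3, 4), (1, 1, 5)]
    [7, 43, 28, 17, 33]
    (.swap 0 4 (.br 6 (.swap 3 2 (.br 5 (.swap 0 3 (.br 5 (.swap 3 1 (.br 10 (.fin [3, 4, 2, 3,
      4]) (.br 18 (.fin [3, 4, 1, 2, 4]) (.br 34 (.fin [3, 4, 1, 2, 4]) (.nil))))) (.br 17 (.fin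
      [4, 3, 1, 2, 1]) (.br 1 (.fin [4, 3, 1, 2, 1]) (.nil))))) (.br 9 (.fin [4, 2, 1, 3, 1])
      (.br 1 (.fin [4, 2, 1, 2, 1]) (.nil))))) (.br 34 (.fin [4, 0, 1, 2, 1]) (.br 2 (.fin [4, 0,
      1, 2, 1]) (.nil)))))
    rfl 6 rfl (by decide +kernel) ?_ ?_
  · simp [e0, c0, e1, c1, e2, c2, e3, c3]
  · simp [f0, f1, f2, f3, f4, f5]

theorem g_2b_nu {G H : SimpleGraph V} {k : ℕ} {φ : V → V → ℕ} {x y z c u : V}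
    {γ β α η₁ η₂ : ℕ} (C : Ctx G H k φ x y)
    (hv : [x, y, z, c, u].Nodup) (hc : [γ, β, α, η₁, η₂].Nodup)
    (hk : ∀ c ∈ [γ, β, α, η₁, η₂], c ∈ Finset.Icc 1 k)
    (e0 : H.Adj x z) (c0 : φ x z = γ) (e1 : H.Adj x c) (c1 : φ x c = β)
    (e2 : H.Adj c u) (c2 : φ c u = α) (e3 : H.Adj y u) (c3 : φ y u = β) (f0 : γ ∉ present H φ y)
    (f1 : α ∉ present H φ z) (f2 : η₁ ∉ present H φ x) (f3 : η₁ ∉ present H φ u)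
    (f4 : η₂ ∉ present H φ x) (f5 : η₂ ∉ present H φ u) : False := by
  refine game C [z, c, u] [γ, β, α, η₁, η₂] hv hc hk
    [(0, 1), (2, 2), (3, 0), (3, 4), (4, 0), (4, 4)]
    [(0, 0, 2), (1, 0, 3), (2, 3, 4), (1, 1, 4)]
    [7, 27, 28, 17, 17]
    (.swap 0 3 (.br 6 (.swap 4 2 (.br 5 (.fin [1, 3, 2, 1, 3]) (.br 9 (.fin [3, 2, 1, 4, 1]) (.br
      1 (.fin [1, 3, 2, 1, 3]) (.nil))))) (.br 18 (.fin [3, 0, 1, 2, 1]) (.br 2 (.fin [3, 0, 1,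
      2, 1]) (.nil)))))
    rfl 5 rfl (by decide +kernel) ?_ ?_
  · simp [e0, c0, e1, c1, e2, c2, e3, c3]
  · simp [f0, f1, f2, f3, f4, f5]

theorem g_2b_vn {G H : SimpleGraph V} {k : ℕ} {φ : V → V → ℕ} {x y z c v u : V}
    {γ β α η₁ η₂ : ℕ} (C : Ctx G H k φ x y)
    (hv : [x, y, z, c, v, u].Nodup) (hc : [γ, β, α, η₁, η₂].Nodup)
    (hk : ∀ c ∈ [γ, β, α, η₁, η₂], c ∈ Finset.Icc 1 k)
    (e0 : H.Adj x z) (c0 : φ x z = γ) (e1 : H.Adj x c) (c1 : φ x c = β)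
    (e2 : H.Adj z v) (c2 : φ z v = α) (e3 : H.Adj y u) (c3 : φ y u = β) (f0 : γ ∉ present H φ y)
    (f1 : α ∉ present H φ c) (f2 : η₁ ∉ present H φ x) (f3 : η₁ ∉ present H φ v)
    (f4 : η₂ ∉ present H φ x) (f5 : η₂ ∉ present H φ u) : False := by
  refine game C [z, c, v, u] [γ, β, α, η₁, η₂] hv hc hk
    [(0, 1), (2, 3), (3, 0), (3, 4), (4, 0), (4, 5)]
    [(0, 0, 2), (1, 0, 3), (2, 2, 4), (1, 1, 5)]
    [7, 43, 28, 17, 33]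
    (.swap 0 2 (.br 3 (.swap 0 3 (.br 5 (.swap 0 2 (.br 6 (.swap 0 4 (.br 6 (.fin [1, 4, 2, 3, 4])
      (.br 34 (.fin [4, 0, 1, 3, 1]) (.br 2 (.fin [1, 0, 2, 3, 4]) (.nil))))) (.br 10 (.fin [0,
      2, 1, 3, 1]) (.br 18 (.fin [0, 2, 1, 3, 1]) (.nil))))) (.br 17 (.fin [2, 0, 1, 2, 1]) (.br
      1 (.fin [2, 0, 1, 2, 1]) (.nil))))) (.br 9 (.swap 0 3 (.br 12 (.swap 0 4 (.br 3 (.fin [1,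
      2, 3, 3, 4]) (.br 33 (.fin [0, 2, 1, 3, 1]) (.br 1 (.fin [0, 2, 1, 3, 1]) (.nil))))) (.br
      20 (.swap 0 4 (.br 3 (.fin [1, 3, 0, 2, 4]) (.br 9 (.fin [0, 3, 1, 2, 1]) (.br 17 (.fin [0,
      3, 1, 2, 1]) (.br 33 (.fin [0, 3, 1, 2, 1]) (.br 1 (.fin [0, 3, 1, 2, 1]) (.nil))))))) (.br
      4 (.swap 0 4 (.br 3 (.fin [1, 2, 0, 3, 4]) (.br 9 (.fin [0, 2, 1, 3, 1]) (.br 33 (.fin [0,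
      2, 1, 3, 1]) (.nil))))) (.br 5 (.fin [0, 2, 1, 3, 1]) (.br 6 (.fin [3, 2, 1, 3, 1]) (.br 18
      (.fin [3, 2, 1, 0, 1]) (.br 11 (.swap 3 4 (.br 3 (.fin [1, 0, 3, 2, 4]) (.br 9 (.fin [3, 0,
      1, 2, 1]) (.br 17 (.fin [3, 0, 1, 2, 1]) (.br 33 (.fin [1, 0, 3, 2, 3]) (.br 1 (.fin [3, 0,
      1, 2, 1]) (.nil))))))) (.br 17 (.fin [0, 2, 1, 0, 1]) (.br 1 (.swap 0 4 (.br 6 (.fin [1, 4,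
      0, 2, 4]) (.br 10 (.fin [1, 0, 4, 2, 4]) (.br 34 (.fin [4, 0, 1, 2, 1]) (.nil)))))
      (.nil))))))))))) (.br 17 (.swap 3 0 (.br 3 (.swap 3 4 (.br 3 (.swap 2 3 (.br 12 (.fin [1,
      0, 3, 3, 4]) (.br 20 (.fin [1, 3, 2, 0, 4]) (.br 4 (.fin [1, 0, 2, 3, 4]) (.nil))))) (.br
      17 (.fin [3, 2, 1, 0, 1]) (.br 33 (.fin [3, 2, 1, 0, 1]) (.nil))))) (.br 5 (.fin [0, 2, 1,
      3, 1]) (.br 1 (.fin [0, 2, 1, 0, 1]) (.nil))))) (.nil)))))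
    rfl 6 rfl (by decide +kernel) ?_ ?_
  · simp [e0, c0, e1, c1, e2, c2, e3, c3]
  · simp [f0, f1, f2, f3, f4, f5]

theorem g_2b_un {G H : SimpleGraph V} {k : ℕ} {φ : V → V → ℕ} {x y z c u : V}
    {γ β α η₁ η₂ : ℕ} (C : Ctx G H k φ x y)
    (hv : [x, y, z, c, u].Nodup) (hc : [γ, β, α, η₁, η₂].Nodup)
    (hk : ∀ c ∈ [γ, β, α, η₁, η₂], c ∈ Finset.Icc 1 k)
    (e0 : H.Adj x z) (c0 : φ x z = γ) (e1 : H.Adj x c) (c1 : φ x c = β)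
    (e2 : H.Adj z u) (c2 : φ z u = α) (e3 : H.Adj y u) (c3 : φ y u = β) (f0 : γ ∉ present H φ y)
    (f1 : α ∉ present H φ c) (f2 : η₁ ∉ present H φ x) (f3 : η₁ ∉ present H φ u)
    (f4 : η₂ ∉ present H φ x) (f5 : η₂ ∉ present H φ u) : False := by
  refine game C [z, c, u] [γ, β, α, η₁, η₂] hv hc hk
    [(0, 1), (2, 3), (3, 0), (3, 4), (4, 0), (4, 4)]
    [(0, 0, 2), (1, 0, 3), (2, 2, 4), (1, 1, 4)]
    [7, 27, 28, 17, 17]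
    (.swap 0 3 (.br 6 (.swap 4 2 (.br 5 (.fin [1, 3, 2, 4, 3]) (.br 9 (.fin [3, 2, 1, 3, 1]) (.br
      1 (.fin [1, 3, 2, 2, 3]) (.nil))))) (.br 18 (.fin [3, 0, 1, 2, 1]) (.br 2 (.fin [3, 0, 1,
      2, 1]) (.nil)))))
    rfl 5 rfl (by decide +kernel) ?_ ?_
  · simp [e0, c0, e1, c1, e2, c2, e3, c3]
  · simp [f0, f1, f2, f3, f4, f5]

theorem g_2b_uw {G H : SimpleGraph V} {k : ℕ} {φ : V → V → ℕ} {x y z c u w : V}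
    {γ β α η₁ η₂ η₃ η₄ : ℕ} (C : Ctx G H k φ x y)
    (hv : [x, y, z, c, u, w].Nodup) (hc : [γ, β, α, η₁, η₂, η₃, η₄].Nodup)
    (hk : ∀ c ∈ [γ, β, α, η₁, η₂, η₃, η₄], c ∈ Finset.Icc 1 k)
    (e0 : H.Adj x z) (c0 : φ x z = γ) (e1 : H.Adj x c) (c1 : φ x c = β)
    (e2 : H.Adj z u) (c2 : φ z u = α) (e3 : H.Adj c w) (c3 : φ c w = α)
    (e4 : H.Adj y u) (c4 : φ y u = β) (f0 : γ ∉ present H φ y) (f1 : η₁ ∉ present H φ x)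
    (f2 : η₁ ∉ present H φ u) (f3 : η₂ ∉ present H φ x) (f4 : η₂ ∉ present H φ u)
    (f5 : η₃ ∉ present H φ x) (f6 : η₃ ∉ present H φ w) (f7 : η₄ ∉ present H φ x)
    (f8 : η₄ ∉ present H φ w) : False := by
  refine game C [z, c, u, w] [γ, β, α, η₁, η₂, η₃, η₄] hv hc hk
    [(0, 1), (3, 0), (3, 4), (4, 0), (4, 4), (5, 0), (5, 5), (6, 0), (6, 5)]
    [(0, 0, 2), (1, 0, 3), (2, 2, 4), (2, 3, 5), (1, 1, 4)]
    [7, 27, 60, 17, 17, 33, 33]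
    (.swap 0 3 (.br 6 (.swap 5 2 (.br 5 (.swap 4 5 (.br 5 (.swap 1 5 (.br 10 (.fin [5, 3, 2, 4, 5,
      3]) (.br 18 (.fin [5, 3, 1, 4, 2, 3]) (.br 34 (.fin [5, 3, 1, 4, 2, 3]) (.nil))))) (.br 17
      (.fin [3, 5, 1, 3, 2, 1]) (.br 33 (.fin [3, 5, 1, 3, 2, 1]) (.nil))))) (.br 9 (.fin [3, 2,
      1, 3, 5, 1]) (.br 17 (.fin [3, 2, 1, 3, 2, 1]) (.nil))))) (.br 18 (.fin [3, 0, 1, 2, 2, 1])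
      (.br 2 (.fin [3, 0, 1, 2, 2, 1]) (.nil)))))
    rfl 6 rfl (by decide +kernel) ?_ ?_
  · simp [e0, c0, e1, c1, e2, c2, e3, c3, e4, c4]
  · simp [f0, f1, f2, f3, f4, f5, f6, f7, f8]

theorem g_2b_vu {G H : SimpleGraph V} {k : ℕ} {φ : V → V → ℕ} {x y z c u v : V}
    {γ β α η₁ η₂ : ℕ} (C : Ctx G H k φ x y)
    (hv : [x, y, z, c, u, v].Nodup) (hc : [γ, β, α, η₁, η₂].Nodup)
    (hk : ∀ c ∈ [γ, β, α, η₁, η₂], c ∈ Finset.Icc 1 k)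
    (e0 : H.Adj x z) (c0 : φ x z = γ) (e1 : H.Adj x c) (c1 : φ x c = β)
    (e2 : H.Adj z v) (c2 : φ z v = α) (e3 : H.Adj c u) (c3 : φ c u = α)
    (e4 : H.Adj y u) (c4 : φ y u = β) (f0 : γ ∉ present H φ y) (f1 : η₁ ∉ present H φ x)
    (f2 : η₁ ∉ present H φ u) (f3 : η₂ ∉ present H φ x) (f4 : η₂ ∉ present H φ v) : False := by
  refine game C [z, c, u, v] [γ, β, α, η₁, η₂] hv hc hk
    [(0, 1), (3, 0), (3, 4), (4, 0), (4, 5)]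
    [(0, 0, 2), (1, 0, 3), (2, 2, 5), (2, 3, 4), (1, 1, 4)]
    [7, 27, 60, 17, 33]
    (.swap 0 2 (.br 3 (.swap 0 4 (.br 5 (.swap 0 2 (.br 6 (.swap 0 3 (.br 6 (.fin [1, 3, 2, 4, 1,
      3]) (.br 18 (.fin [3, 0, 1, 4, 2, 1]) (.br 2 (.fin [1, 0, 2, 4, 1, 3]) (.nil))))) (.br 30
      (.swap 3 0 (.br 6 (.fin [1, 3, 0, 4, 1, 3]) (.br 10 (.fin [1, 0, 3, 4, 1, 3]) (.br 2 (.fin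
      [3, 0, 1, 4, 0, 1]) (.nil))))) (.br 36 (.fin [1, 0, 2, 4, 1, 2]) (.br 4 (.fin [1, 0, 2, 4,
      1, 2]) (.br 34 (.fin [0, 2, 1, 4, 2, 1]) (.br 2 (.fin [0, 2, 1, 4, 2, 1]) (.nil))))))))
      (.br 33 (.fin [1, 0, 2, 2, 1, 2]) (.br 1 (.fin [1, 0, 2, 2, 1, 2]) (.nil))))) (.br 9 (.swap
      0 3 (.br 3 (.swap 0 4 (.br 12 (.fin [1, 2, 4, 4, 1, 3]) (.br 36 (.fin [1, 4, 0, 2, 1, 3])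
      (.br 4 (.fin [1, 2, 0, 4, 1, 3]) (.nil))))) (.br 10 (.swap 0 4 (.br 5 (.fin [1, 2, 3, 4, 1,
      3]) (.br 33 (.fin [1, 0, 3, 2, 1, 3]) (.br 1 (.fin [1, 0, 3, 2, 1, 3]) (.nil))))) (.br 18
      (.swap 0 4 (.br 5 (.fin [3, 2, 1, 4, 0, 1]) (.br 29 (.fin [3, 2, 1, 4, 4, 1]) (.br 36 (.fin
      [3, 4, 1, 2, 0, 1]) (.br 4 (.fin [3, 2, 1, 4, 0, 1]) (.br 33 (.fin [3, 0, 1, 2, 0, 1]) (.br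
      1 (.fin [3, 0, 1, 2, 0, 1]) (.nil)))))))) (.br 7 (.swap 3 4 (.br 23 (.fin [1, 2, 0, 4, 1,
      4]) (.br 36 (.fin [1, 4, 0, 2, 1, 3]) (.br 4 (.fin [1, 2, 0, 4, 1, 3]) (.br 5 (.fin [1, 2,
      0, 4, 1, 3]) (.br 51 (.fin [1, 2, 0, 3, 1, 4]) (.br 19 (.fin [1, 3, 0, 2, 1, 4]) (.br 33
      (.fin [1, 2, 0, 3, 1, 3]) (.br 1 (.fin [1, 3, 0, 2, 1, 3]) (.nil)))))))))) (.br 9 (.swap 0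
      4 (.br 6 (.fin [4, 2, 1, 4, 3, 1]) (.br 34 (.fin [4, 0, 1, 2, 3, 1]) (.br 2 (.fin [4, 0, 1,
      2, 3, 1]) (.nil))))) (.br 17 (.swap 0 4 (.br 6 (.fin [4, 2, 1, 4, 0, 1]) (.br 30 (.fin [1,
      2, 4, 4, 1, 4]) (.br 36 (.fin [0, 4, 1, 2, 0, 1]) (.br 4 (.fin [0, 2, 1, 4, 0, 1]) (.br 12
      (.fin [1, 2, 4, 4, 1, 0]) (.br 34 (.fin [4, 0, 1, 2, 0, 1]) (.br 2 (.fin [4, 0, 1, 2, 0,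
      1]) (.nil))))))))) (.br 1 (.swap 0 2 (.br 10 (.fin [1, 0, 2, 2, 1, 2]) (.br 18 (.fin [2, 0,
      1, 2, 0, 1]) (.br 34 (.fin [1, 2, 0, 0, 1, 2]) (.nil))))) (.nil))))))))) (.br 27 (.swap 3 0
      (.br 5 (.swap 3 4 (.br 5 (.swap 3 2 (.br 6 (.fin [1, 3, 0, 4, 1, 3]) (.br 18 (.fin [3, 2,
      1, 4, 0, 1]) (.br 34 (.fin [1, 2, 0, 4, 1, 3]) (.nil))))) (.br 17 (.fin [2, 3, 1, 2, 0, 1])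
      (.br 33 (.fin [2, 3, 1, 2, 0, 1]) (.nil))))) (.br 9 (.fin [2, 0, 1, 2, 3, 1]) (.br 1 (.fin
      [2, 0, 1, 2, 0, 1]) (.nil))))) (.br 34 (.swap 3 2 (.br 3 (.swap 2 4 (.br 12 (.fin [1, 0, 4,
      4, 1, 3]) (.br 20 (.fin [1, 0, 2, 4, 1, 3]) (.br 36 (.fin [1, 4, 2, 0, 1, 3]) (.nil)))))
      (.br 5 (.swap 3 4 (.br 5 (.fin [1, 0, 2, 4, 1, 2]) (.br 17 (.fin [1, 3, 2, 0, 1, 2]) (.br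
      33 (.fin [1, 0, 2, 3, 1, 2]) (.nil))))) (.br 9 (.swap 2 4 (.br 6 (.fin [4, 0, 1, 4, 3, 1])
      (.br 18 (.fin [4, 2, 1, 0, 3, 1]) (.br 34 (.fin [4, 0, 1, 2, 3, 1]) (.nil))))) (.nil)))))
      (.br 2 (.swap 3 2 (.br 3 (.fin [1, 0, 2, 2, 1, 3]) (.br 10 (.fin [1, 0, 3, 2, 1, 3]) (.br
      39 (.fin [1, 0, 2, 3, 1, 3]) (.br 2 (.fin [3, 0, 1, 2, 2, 1]) (.br 9 (.fin [2, 0, 1, 2, 3,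
      1]) (.br 1 (.fin [1, 0, 2, 2, 1, 2]) (.nil)))))))) (.br 33 (.swap 4 0 (.br 3 (.swap 3 4
      (.br 3 (.swap 2 4 (.br 12 (.fin [1, 0, 4, 4, 1, 3]) (.br 20 (.fin [1, 0, 2, 4, 1, 3]) (.br
      36 (.fin [1, 4, 2, 0, 1, 3]) (.nil))))) (.br 17 (.fin [4, 2, 1, 0, 2, 1]) (.br 33 (.fin [4,
      2, 1, 0, 2, 1]) (.nil))))) (.br 5 (.fin [0, 2, 1, 4, 2, 1]) (.br 1 (.fin [0, 2, 1, 0, 2,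
      1]) (.nil))))) (.br 1 (.swap 0 3 (.br 3 (.fin [1, 0, 2, 2, 1, 3]) (.br 5 (.swap 3 4 (.br 5
      (.fin [0, 2, 1, 4, 2, 1]) (.br 17 (.fin [0, 3, 1, 2, 2, 1]) (.br 33 (.fin [0, 2, 1, 3, 2,
      1]) (.nil))))) (.br 17 (.fin [1, 0, 2, 2, 1, 0]) (.nil))))) (.nil)))))))))
    rfl 6 rfl (by decide +kernel) ?_ ?_
  · simp [e0, c0, e1, c1, e2, c2, e3, c3, e4, c4]
  · simp [f0, f1, f2, f3, f4]

theorem g_2b_vw1 {G H : SimpleGraph V} {k : ℕ} {φ : V → V → ℕ} {x y z c v w u : V}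
    {γ β α η₁ η₂ η₃ η₄ : ℕ} (C : Ctx G H k φ x y)
    (hv : [x, y, z, c, v, w, u].Nodup) (hc : [γ, β, α, η₁, η₂, η₃, η₄].Nodup)
    (hk : ∀ c ∈ [γ, β, α, η₁, η₂, η₃, η₄], c ∈ Finset.Icc 1 k)
    (e0 : H.Adj x z) (c0 : φ x z = γ) (e1 : H.Adj x c) (c1 : φ x c = β)
    (e2 : H.Adj z v) (c2 : φ z v = α) (e3 : H.Adj c w) (c3 : φ c w = α)
    (e4 : H.Adj y u) (c4 : φ y u = β) (f0 : γ ∉ present H φ y) (f1 : η₁ ∉ present H φ x)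
    (f2 : η₁ ∉ present H φ v) (f3 : η₂ ∉ present H φ x) (f4 : η₂ ∉ present H φ v)
    (f5 : η₃ ∉ present H φ x) (f6 : η₃ ∉ present H φ w) (f7 : η₄ ∉ present H φ x)
    (f8 : η₄ ∉ present H φ u) : False := by
  refine game C [z, c, v, w, u] [γ, β, α, η₁, η₂, η₃, η₄] hv hc hk
    [(0, 1), (3, 0), (3, 4), (4, 0), (4, 4), (5, 0), (5, 5), (6, 0), (6, 6)]
    [(0, 0, 2), (1, 0, 3), (2, 2, 4), (2, 3, 5), (1, 1, 6)]
    [7, 75, 60, 17, 17, 33, 65]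
    (.swap 0 3 (.br 6 (.swap 5 2 (.br 5 (.swap 4 5 (.br 5 (.swap 0 3 (.br 6 (.swap 0 6 (.br 6
      (.swap 5 1 (.br 10 (.fin [5, 6, 2, 4, 5, 6]) (.br 34 (.fin [5, 6, 1, 4, 2, 6]) (.br 66
      (.fin [5, 6, 1, 4, 2, 6]) (.nil))))) (.br 66 (.fin [6, 0, 1, 4, 2, 1]) (.br 2 (.fin [6, 0,
      1, 4, 2, 1]) (.nil))))) (.br 18 (.fin [0, 3, 1, 4, 2, 1]) (.br 2 (.fin [0, 3, 1, 4, 2, 1])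
      (.nil))))) (.br 17 (.fin [3, 5, 1, 3, 2, 1]) (.br 33 (.fin [3, 5, 1, 3, 2, 1]) (.nil)))))
      (.br 9 (.fin [3, 2, 1, 3, 5, 1]) (.br 17 (.fin [3, 2, 1, 3, 2, 1]) (.nil))))) (.br 18 (.fin
      [3, 0, 1, 2, 2, 1]) (.br 2 (.fin [3, 0, 1, 2, 2, 1]) (.nil)))))
    rfl 7 rfl (by decide +kernel) ?_ ?_
  · simp [e0, c0, e1, c1, e2, c2, e3, c3, e4, c4]
  · simp [f0, f1, f2, f3, f4, f5, f6, f7, f8]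

theorem g_2b_vw2 {G H : SimpleGraph V} {k : ℕ} {φ : V → V → ℕ} {x y z c v w u : V}
    {γ β α η₁ η₂ η₃ : ℕ} (C : Ctx G H k φ x y)
    (hv : [x, y, z, c, v, w, u].Nodup) (hc : [γ, β, α, η₁, η₂, η₃].Nodup)
    (hk : ∀ c ∈ [γ, β, α, η₁, η₂, η₃], c ∈ Finset.Icc 1 k)
    (e0 : H.Adj x z) (c0 : φ x z = γ) (e1 : H.Adj x c) (c1 : φ x c = β)
    (e2 : H.Adj z v) (c2 : φ z v = α) (e3 : H.Adj c w) (c3 : φ c w = α)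
    (e4 : H.Adj y u) (c4 : φ y u = β) (f0 : γ ∉ present H φ y) (f1 : η₁ ∉ present H φ x)
    (f2 : η₁ ∉ present H φ v) (f3 : η₁ ∉ present H φ w) (f4 : η₁ ∉ present H φ u)
    (f5 : η₂ ∉ present H φ x) (f6 : η₂ ∉ present H φ v) (f7 : η₂ ∉ present H φ w)
    (f8 : η₂ ∉ present H φ u) (f9 : η₃ ∉ present H φ x) (f10 : η₃ ∉ present H φ v)
    (f11 : η₃ ∉ present H φ w) (f12 : η₃ ∉ present H φ u) : False := by
  refine game C [z, c, v, w, u] [γ, β, α, η₁, η₂, η₃] hv hc hk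
    [(0, 1), (3, 0), (3, 4), (3, 5), (3, 6), (4, 0), (4, 4), (4, 5), (4, 6), (5, 0), (5, 4), (5, 5), (5, 6)]
    [(0, 0, 2), (1, 0, 3), (2, 2, 4), (2, 3, 5), (1, 1, 6)]
    [7, 75, 60, 113, 113, 113]
    (.swap 0 3 (.br 6 (.swap 2 4 (.br 5 (.swap 1 5 (.br 10 (.fin [5, 3, 2, 4, 5, 3]) (.br 18 (.fin
      [5, 3, 1, 4, 2, 3]) (.br 34 (.fin [5, 3, 1, 4, 2, 3]) (.nil))))) (.br 9 (.fin [3, 2, 1, 3,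
      4, 1]) (.br 65 (.fin [3, 2, 1, 3, 2, 1]) (.nil))))) (.br 18 (.fin [3, 0, 1, 2, 2, 1]) (.br
      34 (.fin [3, 0, 1, 2, 2, 1]) (.br 66 (.fin [3, 0, 1, 2, 2, 1]) (.br 2 (.fin [3, 0, 1, 2, 2,
      1]) (.nil)))))))
    rfl 7 rfl (by decide +kernel) ?_ ?_
  · simp [e0, c0, e1, c1, e2, c2, e3, c3, e4, c4]
  · simp [f0, f1, f2, f3, f4, f5, f6, f7, f8, f9, f10, f11, f12]

/-! ### Small vertices and shared missing colours -/

/-- The running context with degree information. -/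
structure Env (G H : SimpleGraph V) (k : ℕ) (φ : V → V → ℕ) (x y : V) (sm : V → Prop) : Prop
    extends Ctx G H k φ x y where
  ne : x ≠ y
  nxy : ¬ H.Adj x y
  smd : ∀ v, sm v → (H.neighborSet x).ncard + (H.neighborSet v).ncard + 2 ≤ k
  dx : (H.neighborSet x).ncard + 1 ≤ k
  dy : (H.neighborSet y).ncard + 1 ≤ k

/-- The colour is missing, or leads to a small vertex. -/
def Bad (H : SimpleGraph V) (φ : V → V → ℕ) (sm : V → Prop) (α : ℕ) (v : V) : Prop :=
  α ∉ present H φ v ∨ ∃ v', H.Adj v v' ∧ φ v v' = α ∧ sm v'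

theorem present_finset (H : SimpleGraph V) (φ : V → V → ℕ) (v : V) :
    ∃ S : Finset ℕ, (∀ c, c ∈ S ↔ c ∈ present H φ v) ∧ S.card ≤ (H.neighborSet v).ncard := by
  classical
  refine ⟨(Set.toFinite (H.neighborSet v)).toFinset.image (φ v), ?_, ?_⟩
  · intro c
    simp [present]
  · refine Finset.card_image_le.trans ?_
    rw [Set.ncard_eq_toFinset_card _ (Set.toFinite _)]

theorem exists_missing (H : SimpleGraph V) (φ : V → V → ℕ) (v : V) (k : ℕ)
    (h : (H.neighborSet v).ncard + 1 ≤ k) : ∃ δ ∈ Finset.Icc 1 k, δ ∉ present H φ v := by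
  obtain ⟨S, hS, hc⟩ := present_finset H φ v
  obtain ⟨δ, h1, h2⟩ := Finset.exists_mem_notMem_of_card_lt_card (s := S) (t := Finset.Icc 1 k)
    (by simp; omega)
  exact ⟨δ, h1, fun h => h2 ((hS δ).mpr h)⟩

section env

variable {G H : SimpleGraph V} {k : ℕ} {φ : V → V → ℕ} {x y : V} {sm : V → Prop}

theorem Ctx.proper (C : Ctx G H k φ x y) {v a b : V} (h1 : H.Adj v a) (h2 : H.Adj v b)
    (h : φ v a = φ v b) : a = b := by
  by_contra hne
  exact C.col.2.2 h1 h2 hne h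

theorem Ctx.pres (C : Ctx G H k φ x y) {p q : V} {c : ℕ} (h : H.Adj p q) (hc : φ p q = c) :
    c ∈ present H φ p ∧ c ∈ present H φ q :=
  ⟨⟨q, h, hc⟩, ⟨p, h.symm, by rw [C.col.1]; exact hc⟩⟩

theorem Env.common (E : Env G H k φ x y sm) {v : V} (hv : sm v) (T : Finset ℕ)
    (hT : ∀ c ∈ T, c ∈ present H φ x ∧ c ∈ present H φ v) :
    ∃ S : Finset ℕ, T.card + 2 ≤ S.card ∧
      ∀ c ∈ S, c ∈ Finset.Icc 1 k ∧ c ∉ present H φ x ∧ c ∉ present H φ v := by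
  obtain ⟨A, hA, hAc⟩ := present_finset H φ x
  obtain ⟨B, hB, hBc⟩ := present_finset H φ v
  have h1 := E.smd v hv
  have h2 := Finset.card_union_add_card_inter A B
  have h3 : T.card ≤ (A ∩ B).card := by
    apply Finset.card_le_card
    intro c hc
    rw [Finset.mem_inter, hA, hB]
    exact hT c hc
  refine ⟨Finset.Icc 1 k \ (A ∪ B), ?_, ?_⟩
  · have h4 := Finset.le_card_sdiff (A ∪ B) (Finset.Icc 1 k)
    rw [Nat.card_Icc] at h4
    omega
  · intro c hc
    rw [Finset.mem_sdiff, Finset.mem_union, hA, hB] at hc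
    exact ⟨hc.1, fun h => hc.2 (Or.inl h), fun h => hc.2 (Or.inr h)⟩

theorem Env.avoid (E : Env G H k φ x y sm) {v : V} (hv : sm v) (T : Finset ℕ)
    (hT : ∀ c ∈ T, c ∈ present H φ x ∧ c ∈ present H φ v) (F : Finset ℕ)
    (hF : F.card < T.card + 2) :
    ∃ c, c ∉ F ∧ c ∈ Finset.Icc 1 k ∧ c ∉ present H φ x ∧ c ∉ present H φ v := by
  obtain ⟨S, hS, hm⟩ := E.common hv T hT
  obtain ⟨c, h1, h2⟩ := Finset.exists_mem_notMem_of_card_lt_card (s := F) (t := S) (by omega)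
  exact ⟨c, h2, hm c h1⟩

theorem Env.one (E : Env G H k φ x y sm) {v : V} (hv : sm v) (a : ℕ) :
    ∃ c, c ≠ a ∧ c ∈ Finset.Icc 1 k ∧ c ∉ present H φ x ∧ c ∉ present H φ v := by
  obtain ⟨c, h, h'⟩ := E.avoid hv ∅ (by simp) {a} (by simp)
  exact ⟨c, by simpa using h, h'⟩

theorem Env.two (E : Env G H k φ x y sm) {v : V} (hv : sm v) :
    ∃ c d, d ≠ c ∧ (c ∈ Finset.Icc 1 k ∧ c ∉ present H φ x ∧ c ∉ present H φ v) ∧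
      (d ∈ Finset.Icc 1 k ∧ d ∉ present H φ x ∧ d ∉ present H φ v) := by
  obtain ⟨c, -, h1⟩ := E.one hv 0
  obtain ⟨d, h, h2⟩ := E.one hv c
  exact ⟨c, d, h, h1, h2⟩

theorem Env.no_common (E : Env G H k φ x y sm) {c : ℕ} (hc : c ∈ Finset.Icc 1 k)
    (h1 : c ∉ present H φ x) (h2 : c ∉ present H φ y) : False := by
  refine game E.toCtx [] [c] (by simp [E.ne]) (by simp) (by simpa using hc)
    [(0, 0), (0, 1)] [] [3] (.fin [0]) rfl 2 rfl (by decide +kernel) (by simp) ?_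
  simp [h1, h2]

theorem Env.ysm (E : Env G H k φ x y sm) : ¬ sm y := by
  intro h
  obtain ⟨c, -, h1, h2, h3⟩ := E.one h 0
  exact E.no_common h1 h2 h3

theorem Env.icc (E : Env G H k φ x y sm) {p q : V} (h : H.Adj p q) : φ p q ∈ Finset.Icc 1 k :=
  E.col.2.1 h

theorem Env.zne (E : Env G H k φ x y sm) {z : V} (hz : H.Adj x z) : x ≠ z ∧ y ≠ z :=
  ⟨hz.ne, by rintro rfl; exact E.nxy hz⟩

theorem Env.z_base (E : Env G H k φ x y sm) {z : V} (hz : H.Adj x z)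
    (hg : φ x z ∉ present H φ y) : ¬ sm z := by
  intro hs
  obtain ⟨c, -, h1, h2, h3⟩ := E.one hs 0
  have hzn := E.zne hz
  have hn := E.ne
  have hp := E.pres hz rfl
  have hi := E.icc hz
  exact g_P1_x E.toCtx (z := z) (γ := φ x z) (α := c) (by grind) (by grind) (by grind)
    hz rfl hg h2 h3

theorem Env.wne (E : Env G H k φ x y sm) {z w : V} (hz : H.Adj x z) (hw : H.Adj y w)
    (h : φ y w = φ x z) : w ≠ x ∧ w ≠ y ∧ w ≠ z := by
  refine ⟨?_, hw.ne', ?_⟩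
  · rintro rfl; exact E.nxy hw.symm
  · rintro rfl
    refine E.ne (E.proper hz.symm hw.symm ?_)
    rw [E.col.1, ← h, E.col.1]

theorem Env.z_not_small (E : Env G H k φ x y sm) {z : V} (hz : H.Adj x z)
    (hg : Bad H φ sm (φ x z) y) : ¬ sm z := by
  rcases hg with hg | ⟨w, hw, hwc, hws⟩
  · exact E.z_base hz hg
  · intro hs
    obtain ⟨δ, hδ, hδy⟩ := exists_missing H φ y k E.dy
    have hδx : δ ∈ present H φ x := by
      by_contra h
      exact E.no_common hδ h hδy
    obtain ⟨c, -, h1, h2, h3⟩ := E.one hs 0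
    obtain ⟨d, hd, d1, d2, d3⟩ := E.one hws c
    have hzn := E.zne hz
    have hwn := E.wne hz hw hwc
    have hn := E.ne
    have hp := E.pres hz rfl
    have hp' := E.pres hw hwc
    have hi := E.icc hz
    exact g_small_zA E.toCtx (z := z) (w := w) (γ := φ x z) (η₁ := δ) (η₂ := c) (η₃ := d)
      (by grind) (by grind) (by grind)
      hz rfl hw hwc hδy h2 h3 d2 d3

theorem Env.vne (E : Env G H k φ x y sm) {z v : V} {α : ℕ} (hz : H.Adj x z) (hv : H.Adj z v)
    (hc : φ z v = α) (hα : α ≠ φ x z) (hs : sm v) : v ≠ x ∧ v ≠ y ∧ v ≠ z := by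
  refine ⟨?_, ?_, hv.ne'⟩
  · rintro rfl
    exact hα (by rw [← hc, E.col.1])
  · rintro rfl
    exact E.ysm hs

theorem Env.P1base (E : Env G H k φ x y sm) {z : V} {α : ℕ} (hz : H.Adj x z)
    (hg : φ x z ∉ present H φ y) (hαk : α ∈ Finset.Icc 1 k) (hα : α ≠ φ x z)
    (hb : Bad H φ sm α z) : α ∈ present H φ x ∧ ¬ Bad H φ sm α y := by
  have hzn := E.zne hz
  have hn := E.ne
  have hp := E.pres hz rfl
  have hi := E.icc hz
  have hzs := E.z_base hz hg
  have hαx : α ∈ present H φ x := by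
    by_contra hαx
    rcases hb with hb | ⟨v, hv, hvc, hvs⟩
    · exact g_P1_x E.toCtx (z := z) (γ := φ x z) (α := α) (by grind) (by grind) (by grind)
        hz rfl hg hαx hb
    · obtain ⟨c, d, hcd, c1, d1⟩ := E.two hvs
      have hvn := E.vne hz hv hvc hα hvs
      have hvp := E.pres hv hvc
      exact g_P1_xv E.toCtx (z := z) (v := v) (γ := φ x z) (α := α) (η₁ := c) (η₂ := d)
        (by grind) (by grind) (by grind)
        hz rfl hv hvc hg hαx c1.2.1 c1.2.2 d1.2.1 d1.2.2
  refine ⟨hαx, ?_⟩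
  rintro (hy | ⟨u, hu, huc, hus⟩)
  · rcases hb with hb | ⟨v, hv, hvc, hvs⟩
    · obtain ⟨δ, hδ, hδx⟩ := exists_missing H φ x k E.dx
      exact g_P1_y E.toCtx (z := z) (γ := φ x z) (α := α) (η₁ := δ)
        (by grind) (by grind) (by grind) hz rfl hg hy hb hδx
    · obtain ⟨c, d, hcd, c1, d1⟩ := E.two hvs
      have hvn := E.vne hz hv hvc hα hvs
      exact g_P1_yv E.toCtx (z := z) (v := v) (γ := φ x z) (α := α) (η₁ := c) (η₂ := d)
        (by grind) (by grind) (by grind)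
        hz rfl hv hvc hg hy c1.2.1 c1.2.2 d1.2.1 d1.2.2
  · have hun : u ≠ x ∧ u ≠ y ∧ u ≠ z :=
      ⟨by rintro rfl; exact E.nxy hu.symm, hu.ne', by rintro rfl; exact hzs hus⟩
    rcases hb with hb | ⟨v, hv, hvc, hvs⟩
    · obtain ⟨c, d, hcd, c1, d1⟩ := E.two hus
      exact g_P1_u E.toCtx (z := z) (u := u) (γ := φ x z) (α := α) (η₁ := c) (η₂ := d)
        (by grind) (by grind) (by grind)
        hz rfl hu huc hg hb c1.2.1 c1.2.2 d1.2.1 d1.2.2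
    · obtain ⟨c, -, c1⟩ := E.one hus 0
      obtain ⟨d, hcd, d1⟩ := E.one hvs c
      have hvn := E.vne hz hv hvc hα hvs
      have huv : u ≠ v := by
        rintro rfl
        refine hzn.2 (E.proper hu.symm hv.symm ?_)
        rw [E.col.1 u y, E.col.1 u z, huc, hvc]
      exact g_P1_uv E.toCtx (z := z) (u := u) (v := v) (γ := φ x z) (α := α) (η₁ := c) (η₂ := d)
        (by grind) (by grind) (by grind)
        hz rfl hu huc hv hvc hg c1.2.1 c1.2.2 d1.2.1 d1.2.2


/-! ### Moving a colour away from `y` -/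

theorem bad_congr {φ' : V → V → ℕ} {c : ℕ}
    (h : ∀ p q, H.Adj p q → (φ' p q = c ↔ φ p q = c)) (v : V) :
    (c ∈ present H φ' v ↔ c ∈ present H φ v) ∧ (Bad H φ' sm c v ↔ Bad H φ sm c v) := by
  have h1 : c ∈ present H φ' v ↔ c ∈ present H φ v := by
    constructor
    · rintro ⟨u, hu, hc⟩; exact ⟨u, hu, (h _ _ hu).mp hc⟩
    · rintro ⟨u, hu, hc⟩; exact ⟨u, hu, (h _ _ hu).mpr hc⟩
  refine ⟨h1, or_congr (not_congr h1) ?_⟩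
  constructor
  · rintro ⟨u, hu, hc, hs⟩; exact ⟨u, hu, (h _ _ hu).mp hc, hs⟩
  · rintro ⟨u, hu, hc, hs⟩; exact ⟨u, hu, (h _ _ hu).mpr hc, hs⟩

theorem Env.shift (E : Env G H k φ x y sm) {w : V} {γ : ℕ} (hw : H.Adj y w) (hwc : φ y w = γ)
    (hws : sm w) (hγ : γ ∈ present H φ x) (a : ℕ) :
    ∃ φ', Env G H k φ' x y sm ∧ γ ∉ present H φ' y ∧
      (∀ z, H.Adj x z → φ x z = γ → φ' x z = γ) ∧
      ∀ c ∈ present H φ y, c ≠ γ → (c ∈ present H φ x ∨ c = a) →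
        ∀ p q, H.Adj p q → (φ' p q = c ↔ φ p q = c) := by
  classical
  obtain ⟨δ, hδ, hδy⟩ := exists_missing H φ y k E.dy
  have hδx : δ ∈ present H φ x := by
    by_contra h
    exact E.no_common hδ h hδy
  obtain ⟨η, hηa, hη, hηx, hηw⟩ := E.one hws a
  have hδη : δ ≠ η := by rintro rfl; exact hηx hδx
  have hγy := (E.pres hw hwc).1
  have hδγ : δ ≠ γ := by rintro rfl; exact hδy hγy
  have hηγ : η ≠ γ := by rintro rfl; exact hηx hγ
  have hwx : x ≠ w := by rintro rfl; exact E.nxy hw.symm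
  have hwy : y ≠ w := hw.ne
  obtain ⟨r, hr, h3, hsw⟩ := kempe H k φ E.col δ η hδ hη
  have hxy : r x y := by
    by_contra hxy
    obtain ⟨ψ, hψ, hin, hout⟩ := hsw {v | r y v} (fun a b hab ha => hr.trans ha hab)
    have E' : Env G H k ψ x y sm := ⟨⟨E.nc, hψ, E.sub⟩, E.ne, E.nxy, E.smd, E.dx, E.dy⟩
    refine E'.no_common hη ?_ ?_
    · rintro ⟨u, hu, huc⟩
      rw [hout x u hu (fun h => hxy (hr.symm h))] at huc
      exact hηx ⟨u, hu, huc⟩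
    · rintro ⟨u, hu, huc⟩
      rw [hin y u hu (hr.refl y)] at huc
      refine hδy ⟨u, hu, ?_⟩
      rw [Equiv.swap_apply_eq_iff, Equiv.swap_apply_right] at huc
      exact huc
  have hyw : ¬ r w y := fun h =>
    h3 x y w hxy (hr.trans hxy (hr.symm h)) E.ne hwx hwy (Or.inr hηx) (Or.inl hδy) (Or.inr hηw)
  have hxw : ¬ r w x := fun h => hyw (hr.trans h hxy)
  obtain ⟨ψ, hψ, hin, hout⟩ := hsw {v | r w v} (fun a b hab ha => hr.trans ha hab)
  have hsame : ∀ c, c ≠ δ → c ≠ η → ∀ p q, H.Adj p q → (ψ p q = c ↔ φ p q = c) := by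
    intro c h1 h2 p q hpq
    by_cases hp : r w p
    · rw [hin p q hpq hp, Equiv.swap_apply_eq_iff, Equiv.swap_apply_of_ne_of_ne h1 h2]
    · rw [hout p q hpq hp]
  have hwδ : δ ∉ present H ψ w := by
    rintro ⟨u, hu, huc⟩
    rw [hin w u hu (hr.refl w), Equiv.swap_apply_eq_iff, Equiv.swap_apply_left] at huc
    exact hηw ⟨u, hu, huc⟩
  have hyδ : δ ∉ present H ψ y := by
    rintro ⟨u, hu, huc⟩
    rw [hout y u hu hyw] at huc
    exact hδy ⟨u, hu, huc⟩
  have hmδ : ∀ v b, s(v, b) = s(y, w) → δ ∉ present H ψ v := by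
    intro v b h
    rw [Sym2.eq_iff] at h
    rcases h with ⟨rfl, -⟩ | ⟨rfl, -⟩
    · exact hyδ
    · exact hwδ
  let φ' : V → V → ℕ := fun p q => if s(p, q) = s(y, w) then δ else ψ p q
  have hc' : IsEdgeColoring H k φ' := by
    refine ⟨?_, ?_, ?_⟩
    · intro u v
      simp only [φ', Sym2.eq_swap (a := u) (b := v), hψ.1 u v]
    · intro u v huv
      simp only [φ']
      split_ifs
      · exact hδ
      · exact hψ.2.1 huv
    · intro v a b ha hb hab
      simp only [φ']
      split_ifs with h1 h2 h2
      · exfalso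
        rw [← h2, Sym2.eq_iff] at h1
        rcases h1 with ⟨-, h⟩ | ⟨h, h'⟩
        · exact hab h
        · exact hab (h'.trans h)
      · intro h
        exact hmδ v a h1 ⟨b, hb, h.symm⟩
      · intro h
        exact hmδ v b h2 ⟨a, ha, h⟩
      · exact hψ.2.2 ha hb hab
  refine ⟨φ', ⟨⟨E.nc, hc', E.sub⟩, E.ne, E.nxy, E.smd, E.dx, E.dy⟩, ?_, ?_, ?_⟩
  · rintro ⟨u, hu, huc⟩
    simp only [φ'] at huc
    split_ifs at huc with h
    · exact hδγ huc
    · rw [hsame γ hδγ.symm hηγ.symm y u hu] at huc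
      apply h
      rw [E.proper hu hw (huc.trans hwc.symm)]
  · intro z hz hzc
    simp only [φ']
    rw [if_neg, hsame γ hδγ.symm hηγ.symm x z hz, hzc]
    intro h
    rw [Sym2.eq_iff] at h
    rcases h with ⟨h, -⟩ | ⟨h, -⟩
    · exact E.ne h
    · exact hwx h
  · intro c hcy hcγ hcx p q hpq
    have h1 : c ≠ δ := by rintro rfl; exact hδy hcy
    have h2 : c ≠ η := by
      rintro rfl
      rcases hcx with h | h
      · exact hηx h
      · exact hηa h
    simp only [φ']
    split_ifs with h
    · have : φ p q = γ := by
        rw [Sym2.eq_iff] at h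
        rcases h with ⟨rfl, rfl⟩ | ⟨rfl, rfl⟩
        · exact hwc
        · rw [E.col.1]; exact hwc
      rw [this]
      exact ⟨fun h => absurd h.symm h1, fun h => absurd h.symm hcγ⟩
    · exact hsame c h1 h2 p q hpq

theorem Env.P1 (E : Env G H k φ x y sm) {z : V} {α : ℕ} (hz : H.Adj x z)
    (hg : Bad H φ sm (φ x z) y) (hαk : α ∈ Finset.Icc 1 k) (hα : α ≠ φ x z)
    (hb : Bad H φ sm α z) : α ∈ present H φ x ∧ ¬ Bad H φ sm α y := by
  have hzs := E.z_not_small hz hg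
  rcases hg with hg | ⟨w, hw, hwc, hws⟩
  · exact E.P1base hz hg hαk hα hb
  have hzn := E.zne hz
  have hwn := E.wne hz hw hwc
  have hn := E.ne
  have hp := E.pres hz rfl
  have hi := E.icc hz
  by_cases hαy : α ∈ present H φ y
  · obtain ⟨φ', E', h1, h2, h3⟩ := E.shift hw hwc hws hp.1 α
    have h4 := h3 α hαy hα (Or.inr rfl)
    have hzc := h2 z hz rfl
    have := E'.P1base hz (by rwa [hzc]) hαk (by rwa [hzc]) ((bad_congr h4 z).2.mpr hb)
    rwa [(bad_congr (sm := sm) h4 x).1, (bad_congr h4 y).2] at this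
  · exfalso
    have hαx : α ∈ present H φ x := by
      by_contra h
      exact E.no_common hαk h hαy
    rcases hb with hb | ⟨v, hv, hvc, hvs⟩
    · obtain ⟨c, d, hcd, c1, d1⟩ := E.two hws
      exact g_P1A_y E.toCtx (z := z) (w := w) (γ := φ x z) (α := α) (η₁ := c) (η₂ := d)
        (by grind) (by grind) (by grind)
        hz rfl hw hwc hαy hb c1.2.1 c1.2.2 d1.2.1 d1.2.2
    · have hvn := E.vne hz hv hvc hα hvs
      by_cases hvw : v = w
      · subst hvw
        obtain ⟨c, d, hcd, c1, d1⟩ := E.two hws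
        exact g_P1A_yw E.toCtx (z := z) (w := v) (γ := φ x z) (α := α) (η₁ := c) (η₂ := d)
          (by grind) (by grind) (by grind)
          hz rfl hv hvc hw hwc hαy c1.2.1 c1.2.2 d1.2.1 d1.2.2
      · obtain ⟨c, -, c1⟩ := E.one hvs 0
        obtain ⟨d, hcd, d1⟩ := E.one hws c
        exact g_P1A_yv E.toCtx (z := z) (v := v) (w := w) (γ := φ x z) (α := α) (η₁ := c)
          (η₂ := d) (by grind) (by grind) (by grind)
          hz rfl hv hvc hw hwc hαy c1.2.1 c1.2.2 d1.2.1 d1.2.2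

theorem hall3 (A B C : Finset ℕ) (hA : 3 ≤ A.card) (hB : 3 ≤ B.card) (hC : 3 ≤ C.card) :
    (∃ a₁ ∈ A, ∃ a₂ ∈ A, ∃ b ∈ B, ∃ c ∈ C, [a₁, a₂, b, c].Nodup) ∨
    (∃ a b c : ℕ, (a ∈ A ∧ a ∈ B ∧ a ∈ C) ∧ (b ∈ A ∧ b ∈ B ∧ b ∈ C) ∧
      (c ∈ A ∧ c ∈ B ∧ c ∈ C) ∧ [a, b, c].Nodup) := by
  have pick : ∀ (S F : Finset ℕ), F.card < S.card → ∃ s ∈ S, s ∉ F := fun S F h =>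
    Finset.exists_mem_notMem_of_card_lt_card h
  have c1 : ∀ a : ℕ, ({a} : Finset ℕ).card ≤ 1 := fun a => by simp
  have c2 : ∀ a b : ℕ, ({a, b} : Finset ℕ).card ≤ 2 := fun a b => Finset.card_le_two
  have c3 : ∀ a b c : ℕ, ({a, b, c} : Finset ℕ).card ≤ 3 := fun a b c => Finset.card_le_three
  by_cases h1 : ∃ b ∈ B, b ∉ A
  · obtain ⟨b, hb, hbA⟩ := h1
    obtain ⟨c, hc, hcb⟩ := pick C {b} (by have := c1 b; omega)
    obtain ⟨a, ha, hac⟩ := pick A {c} (by have := c1 c; omega)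
    obtain ⟨a', ha', hac'⟩ := pick A {c, a} (by have := c2 c a; omega)
    left
    exact ⟨a, ha, a', ha', b, hb, c, hc, by grind⟩
  by_cases h2 : ∃ c ∈ C, c ∉ A
  · obtain ⟨c, hc, hcA⟩ := h2
    obtain ⟨b, hb, hcb⟩ := pick B {c} (by have := c1 c; omega)
    obtain ⟨a, ha, hac⟩ := pick A {b} (by have := c1 b; omega)
    obtain ⟨a', ha', hac'⟩ := pick A {b, a} (by have := c2 b a; omega)
    left
    exact ⟨a, ha, a', ha', b, hb, c, hc, by grind⟩
  push Not at h1 h2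
  by_cases h3 : 4 ≤ A.card
  · obtain ⟨b, hb, -⟩ := pick B ∅ (by rw [Finset.card_empty]; omega)
    obtain ⟨c, hc, hcb⟩ := pick C {b} (by have := c1 b; omega)
    obtain ⟨a, ha, hac⟩ := pick A {b, c} (by have := c2 b c; omega)
    obtain ⟨a', ha', hac'⟩ := pick A {b, c, a} (by have := c3 b c a; omega)
    left
    exact ⟨a, ha, a', ha', b, hb, c, hc, by grind⟩
  · have e1 : B = A := Finset.eq_of_subset_of_card_le h1 (by omega)
    have e2 : C = A := Finset.eq_of_subset_of_card_le h2 (by omega)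
    subst e1 e2
    obtain ⟨a, ha, -⟩ := pick C ∅ (by rw [Finset.card_empty]; omega)
    obtain ⟨b, hb, hab⟩ := pick C {a} (by have := c1 a; omega)
    obtain ⟨c, hc, hac⟩ := pick C {a, b} (by have := c2 a b; omega)
    right
    exact ⟨a, b, c, ⟨ha, ha, ha⟩, ⟨hb, hb, hb⟩, ⟨hc, hc, hc⟩, by grind⟩

theorem nodup3 {γ β α : ℕ} {l : List ℕ} (h1 : γ ≠ β) (h2 : γ ≠ α) (h3 : β ≠ α) (h : l.Nodup)
    (hl : ∀ e ∈ l, γ ≠ e ∧ β ≠ e ∧ α ≠ e) : (γ :: β :: α :: l).Nodup := by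
  simp only [List.nodup_cons, List.mem_cons, not_or]
  exact ⟨⟨h1, h2, fun hm => (hl _ hm).1 rfl⟩, ⟨h3, fun hm => (hl _ hm).2.1 rfl⟩,
    fun hm => (hl _ hm).2.2 rfl, h⟩

theorem nodup4 {x y z c : V} {l : List V} (h1 : x ≠ y) (h2 : x ≠ z) (h3 : x ≠ c) (h4 : y ≠ z)
    (h5 : y ≠ c) (h6 : z ≠ c) (h : l.Nodup)
    (hl : ∀ e ∈ l, e ≠ x ∧ e ≠ y ∧ e ≠ z ∧ e ≠ c) : (x :: y :: z :: c :: l).Nodup := by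
  simp only [List.nodup_cons, List.mem_cons, not_or]
  exact ⟨⟨h1, h2, h3, fun hm => (hl _ hm).1 rfl⟩, ⟨h4, h5, fun hm => (hl _ hm).2.1 rfl⟩,
    ⟨h6, fun hm => (hl _ hm).2.2.1 rfl⟩, fun hm => (hl _ hm).2.2.2 rfl, h⟩

/-- Part 2 when the first colour is missing at `y`. -/
theorem Env.P2aux (E : Env G H k φ x y sm) {z c : V} {α : ℕ} (hz : H.Adj x z) (hc : H.Adj x c)
    (hzc : z ≠ c) (hg : φ x z ∉ present H φ y) (hg' : Bad H φ sm (φ x c) y)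
    (hαk : α ∈ Finset.Icc 1 k) (hα : α ≠ φ x z) (hα' : α ≠ φ x c)
    (hb : Bad H φ sm α z) (hb' : Bad H φ sm α c) (hαx : α ∈ present H φ x) : False := by
  have hzs := E.z_base hz hg
  have hcs := E.z_not_small hc hg'
  have hzn := E.zne hz
  have hcn := E.zne hc
  have hn := E.ne
  have hp := E.pres hz rfl
  have hp' := E.pres hc rfl
  have hi := E.icc hz
  have hi' := E.icc hc
  have hzcc : φ x z ≠ φ x c := fun h => hzc (E.proper hz hc h)
  have hvw : ∀ v, H.Adj z v → H.Adj c v → φ z v = α → φ c v = α → False := by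
    intro v h1 h2 h3 h4
    refine hzc (E.proper h1.symm h2.symm ?_)
    rw [E.col.1 v z, E.col.1 v c, h3, h4]
  have hzv : ∀ v, H.Adj z v → φ z v = α → sm v → v ≠ x ∧ v ≠ y ∧ v ≠ z ∧ v ≠ c := by
    intro v h1 h2 h3
    obtain ⟨a1, a2, a3⟩ := E.vne hz h1 h2 hα h3
    exact ⟨a1, a2, a3, by rintro rfl; exact hcs h3⟩
  have hcv : ∀ v, H.Adj c v → φ c v = α → sm v → v ≠ x ∧ v ≠ y ∧ v ≠ z ∧ v ≠ c := by
    intro v h1 h2 h3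
    obtain ⟨a1, a2, a3⟩ := E.vne hc h1 h2 hα' h3
    exact ⟨a1, a2, by rintro rfl; exact hzs h3, a3⟩
  have nV : ∀ l : List V, l.Nodup → (∀ e ∈ l, e ≠ x ∧ e ≠ y ∧ e ≠ z ∧ e ≠ c) →
      (x :: y :: z :: c :: l).Nodup := fun l =>
    nodup4 hn hzn.1 hcn.1 hzn.2 hcn.2 hzc
  have nC : ∀ l : List ℕ, l.Nodup → (∀ e ∈ l, e ∉ present H φ x) →
      (φ x z :: φ x c :: α :: l).Nodup := fun l h h' =>
    nodup3 hzcc hα.symm hα'.symm h (fun e he =>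
      ⟨fun h => h' e he (h ▸ hp.1), fun h => h' e he (h ▸ hp'.1), fun h => h' e he (h ▸ hαx)⟩)
  have nI : ∀ l : List ℕ, (∀ e ∈ l, e ∈ Finset.Icc 1 k) →
      ∀ e ∈ φ x z :: φ x c :: α :: l, e ∈ Finset.Icc 1 k := fun l h => by
    rw [List.forall_mem_cons, List.forall_mem_cons, List.forall_mem_cons]
    exact ⟨hi, hi', hαk, h⟩
  rcases hg' with hg' | ⟨u, hu, huc, hus⟩
  · rcases hb with hb | ⟨v, hv, hvc, hvs⟩ <;> rcases hb' with hb' | ⟨w, hw, hwc, hws⟩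
    · obtain ⟨δ, hδ, hδx⟩ := exists_missing H φ x k E.dx
      exact g_2a_nn E.toCtx (z := z) (c := c) (γ := φ x z) (β := φ x c) (α := α) (η₁ := δ)
          (nV _ (by simp) (by simp))
          (nC _ (by simp) (by simp [hδ, hδx])) (nI _ (by simp [hδ, hδx, -Finset.mem_Icc]))
          hz rfl hc rfl hg hg' hb hb' hδx
    · obtain ⟨s, t, hst, s1, t1⟩ := E.two hws
      have hwn := hcv w hw hwc hws
      exact g_2a_nv E.toCtx (z := z) (c := c) (w := w) (γ := φ x z) (β := φ x c) (α := α)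
        (η₁ := s) (η₂ := t)
          (nV _ (by simp) (by simp [hwn]))
          (nC _ (by simp [hst.symm]) (by simp [s1, t1])) (nI _ (by simp [s1, t1, -Finset.mem_Icc]))
          hz rfl hc rfl hw hwc hg hg' hb
        s1.2.1 s1.2.2 t1.2.1 t1.2.2
    · obtain ⟨s, t, hst, s1, t1⟩ := E.two hvs
      have hvn := hzv v hv hvc hvs
      have m1 := nV [v] (by simp) (by simp [hvn])
      have m2 := nC [s, t] (by simp [hst.symm]) (by simp [s1, t1])
      have m3 := nI [s, t] (by simp [s1, t1, -Finset.mem_Icc])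
      exact g_2a_nv E.toCtx (z := c) (c := z) (w := v) (γ := φ x c) (β := φ x z) (α := α)
        (η₁ := s) (η₂ := t) (by clear * - m1; grind)
        (by clear * - m2; grind) (by clear * - m3; grind) hc rfl hz rfl hv hvc hg' hg hb'
        s1.2.1 s1.2.2 t1.2.1 t1.2.2
    · obtain ⟨s, -, s1⟩ := E.one hvs 0
      obtain ⟨t, hst, t1⟩ := E.one hws s
      have hvn := hzv v hv hvc hvs
      have hwn := hcv w hw hwc hws
      have hvw' : v ≠ w := by rintro rfl; exact hvw v hv hw hvc hwc
      exact g_2a_vv E.toCtx (z := z) (c := c) (v := v) (w := w) (γ := φ x z) (β := φ x c)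
        (α := α) (η₁ := s) (η₂ := t)
          (nV _ (by simp [hvw']) (by simp [hvn, hwn]))
          (nC _ (by simp [hst.symm]) (by simp [s1, t1])) (nI _ (by simp [s1, t1, -Finset.mem_Icc]))
          hz rfl hc rfl hv hvc hw hwc
        hg hg' s1.2.1 s1.2.2 t1.2.1 t1.2.2
  · have hun0 := E.wne hc hu huc
    have hun : u ≠ x ∧ u ≠ y ∧ u ≠ z ∧ u ≠ c :=
      ⟨hun0.1, hun0.2.1, by rintro rfl; exact hzs hus, hun0.2.2⟩
    rcases hb with hb | ⟨v, hv, hvc, hvs⟩ <;> rcases hb' with hb' | ⟨w, hw, hwc, hws⟩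
    · obtain ⟨s, t, hst, s1, t1⟩ := E.two hus
      exact g_2b_nn E.toCtx (z := z) (c := c) (u := u) (γ := φ x z) (β := φ x c) (α := α)
        (η₁ := s) (η₂ := t)
          (nV _ (by simp) (by simp [hun]))
          (nC _ (by simp [hst.symm]) (by simp [s1, t1])) (nI _ (by simp [s1, t1, -Finset.mem_Icc]))
          hz rfl hc rfl hu huc hg hb hb'
        s1.2.1 s1.2.2 t1.2.1 t1.2.2
    · have hwn := hcv w hw hwc hws
      by_cases hwu : w = u
      · subst hwu
        obtain ⟨s, t, hst, s1, t1⟩ := E.two hus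
        exact g_2b_nu E.toCtx (z := z) (c := c) (u := w) (γ := φ x z) (β := φ x c) (α := α)
          (η₁ := s) (η₂ := t)
          (nV _ (by simp) (by simp [hun]))
          (nC _ (by simp [hst.symm]) (by simp [s1, t1])) (nI _ (by simp [s1, t1, -Finset.mem_Icc]))
          hz rfl hc rfl hw hwc hu huc hg hb
          s1.2.1 s1.2.2 t1.2.1 t1.2.2
      · obtain ⟨s, -, s1⟩ := E.one hws 0
        obtain ⟨t, hst, t1⟩ := E.one hus s
        exact g_2b_nw E.toCtx (z := z) (c := c) (w := w) (u := u) (γ := φ x z) (β := φ x c)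
          (α := α) (η₁ := s) (η₂ := t)
          (nV _ (by simp [hwu]) (by simp [hwn, hun]))
          (nC _ (by simp [hst.symm]) (by simp [s1, t1])) (nI _ (by simp [s1, t1, -Finset.mem_Icc]))
          hz rfl hc rfl hw hwc
          hu huc hg hb s1.2.1 s1.2.2 t1.2.1 t1.2.2
    · have hvn := hzv v hv hvc hvs
      by_cases hvu : v = u
      · subst hvu
        obtain ⟨s, t, hst, s1, t1⟩ := E.two hus
        exact g_2b_un E.toCtx (z := z) (c := c) (u := v) (γ := φ x z) (β := φ x c) (α := α)
          (η₁ := s) (η₂ := t)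
          (nV _ (by simp) (by simp [hun]))
          (nC _ (by simp [hst.symm]) (by simp [s1, t1])) (nI _ (by simp [s1, t1, -Finset.mem_Icc]))
          hz rfl hc rfl hv hvc hu huc hg hb'
          s1.2.1 s1.2.2 t1.2.1 t1.2.2
      · obtain ⟨s, -, s1⟩ := E.one hvs 0
        obtain ⟨t, hst, t1⟩ := E.one hus s
        exact g_2b_vn E.toCtx (z := z) (c := c) (v := v) (u := u) (γ := φ x z) (β := φ x c)
          (α := α) (η₁ := s) (η₂ := t)
          (nV _ (by simp [hvu]) (by simp [hvn, hun]))
          (nC _ (by simp [hst.symm]) (by simp [s1, t1])) (nI _ (by simp [s1, t1, -Finset.mem_Icc]))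
          hz rfl hc rfl hv hvc
          hu huc hg hb' s1.2.1 s1.2.2 t1.2.1 t1.2.2
    · have hvn := hzv v hv hvc hvs
      have hwn := hcv w hw hwc hws
      have hvw' : v ≠ w := by rintro rfl; exact hvw v hv hw hvc hwc
      have hvα := (E.pres hv hvc).2
      have hwα := (E.pres hw hwc).2
      have huβ := (E.pres hu huc).2
      by_cases hvu : v = u
      · subst hvu
        obtain ⟨s, t, hst, s1, t1⟩ := E.two hws
        obtain ⟨p, hp0, p1⟩ := E.avoid hus {φ x c, α} (by
          intro e he
          rw [Finset.mem_insert, Finset.mem_singleton] at he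
          rcases he with rfl | rfl
          · exact ⟨hp'.1, huβ⟩
          · exact ⟨hαx, hvα⟩) {s, t} (by
          rw [Finset.card_pair (Ne.symm hα')]
          have := Finset.card_le_two (a := s) (b := t)
          omega)
        obtain ⟨q, hq0, q1⟩ := E.avoid hus {φ x c, α} (by
          intro e he
          rw [Finset.mem_insert, Finset.mem_singleton] at he
          rcases he with rfl | rfl
          · exact ⟨hp'.1, huβ⟩
          · exact ⟨hαx, hvα⟩) {s, t, p} (by
          rw [Finset.card_pair (Ne.symm hα')]
          have := Finset.card_le_three (a := s) (b := t) (c := p)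
          omega)
        have hnd : [p, q, s, t].Nodup := by
          clear * - hp0 hq0 hst
          grind
        exact g_2b_uw E.toCtx (z := z) (c := c) (u := v) (w := w) (γ := φ x z) (β := φ x c)
          (α := α) (η₁ := p) (η₂ := q) (η₃ := s) (η₄ := t)
          (nV _ (by simp [hvw']) (by simp [hvn, hwn]))
          (nC _ hnd (by simp [p1, q1, s1, t1])) (nI _ (by simp [p1, q1, s1, t1, -Finset.mem_Icc]))
         
          hz rfl hc rfl hv hvc hw hwc hu huc hg p1.2.1 p1.2.2 q1.2.1 q1.2.2
          s1.2.1 s1.2.2 t1.2.1 t1.2.2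
      by_cases hwu : w = u
      · subst hwu
        obtain ⟨s, -, s1⟩ := E.one hus 0
        obtain ⟨t, hst, t1⟩ := E.one hvs s
        exact g_2b_vu E.toCtx (z := z) (c := c) (u := w) (v := v) (γ := φ x z) (β := φ x c)
          (α := α) (η₁ := s) (η₂ := t)
          (nV _ (by simp [Ne.symm hvu]) (by simp [hvn, hun]))
          (nC _ (by simp [hst.symm]) (by simp [s1, t1])) (nI _ (by simp [s1, t1, -Finset.mem_Icc]))
          hz rfl hc rfl hv hvc
          hw hwc hu huc hg s1.2.1 s1.2.2 t1.2.1 t1.2.2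
      obtain ⟨SA, hSA, mA⟩ := E.common hvs {α} (by simpa using ⟨hαx, hvα⟩)
      obtain ⟨SB, hSB, mB⟩ := E.common hws {α} (by simpa using ⟨hαx, hwα⟩)
      obtain ⟨SC, hSC, mC⟩ := E.common hus {φ x c} (by simpa using ⟨hp'.1, huβ⟩)
      rw [Finset.card_singleton] at hSA hSB hSC
      rcases hall3 SA SB SC hSA hSB hSC with ⟨a, ha, a', ha', b, hb, d, hd, hnd⟩ |
        ⟨a, b, d, ⟨a1, a2, a3⟩, ⟨b1, b2, b3⟩, ⟨d1, d2, d3⟩, hnd⟩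
      · have qa := mA a ha
        have qa' := mA a' ha'
        have qb := mB b hb
        have qd := mC d hd
        exact g_2b_vw1 E.toCtx (z := z) (c := c) (v := v) (w := w) (u := u) (γ := φ x z)
          (β := φ x c) (α := α) (η₁ := a) (η₂ := a') (η₃ := b) (η₄ := d)
          (nV _ (by simp [hvw', hvu, hwu]) (by simp [hvn, hwn, hun]))
          (nC _ hnd (by simp [qa, qa', qb, qd])) (nI _ (by simp [qa, qa', qb, qd, -Finset.mem_Icc]))
          hz rfl hc rfl hv hvc hw hwc hu huc hg qa.2.1 qa.2.2 qa'.2.1 qa'.2.2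
          qb.2.1 qb.2.2 qd.2.1 qd.2.2
      · have qa := mA a a1
        have qb := mA b b1
        have qd := mA d d1
        exact g_2b_vw2 E.toCtx (z := z) (c := c) (v := v) (w := w) (u := u) (γ := φ x z)
          (β := φ x c) (α := α) (η₁ := a) (η₂ := b) (η₃ := d)
          (nV _ (by simp [hvw', hvu, hwu]) (by simp [hvn, hwn, hun]))
          (nC _ hnd (by simp [qa, qb, qd])) (nI _ (by simp [qa, qb, qd, -Finset.mem_Icc]))
          hz rfl hc rfl hv hvc hw hwc hu huc hg
          qa.2.1 qa.2.2 (mB a a2).2.2 (mC a a3).2.2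
          qb.2.1 qb.2.2 (mB b b2).2.2 (mC b b3).2.2
          qd.2.1 qd.2.2 (mB d d2).2.2 (mC d d3).2.2

theorem Env.P2 (E : Env G H k φ x y sm) {z c : V} {α : ℕ} (hz : H.Adj x z) (hc : H.Adj x c)
    (hzc : z ≠ c) (hg : Bad H φ sm (φ x z) y) (hg' : Bad H φ sm (φ x c) y)
    (hαk : α ∈ Finset.Icc 1 k)
    (hb : Bad H φ sm α z) (hb' : Bad H φ sm α c) : False := by
  have hzcc : φ x z ≠ φ x c := fun h => hzc (E.proper hz hc h)
  have hα : α ≠ φ x z := by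
    rintro rfl
    exact (E.P1 hc hg' hαk hzcc hb').2 hg
  have hα' : α ≠ φ x c := by
    rintro rfl
    exact (E.P1 hz hg hαk hzcc.symm hb).2 hg'
  obtain ⟨hαx, hαy⟩ := E.P1 hz hg hαk hα hb
  have hαy : α ∈ present H φ y := by
    by_contra h
    exact hαy (Or.inl h)
  by_cases h1 : φ x z ∈ present H φ y
  · by_cases h2 : φ x c ∈ present H φ y
    · rcases hg with hg | ⟨w, hw, hwc, hws⟩
      · exact hg h1
      have hp' := E.pres hc rfl
      obtain ⟨φ', E', k1, k2, k3⟩ := E.shift hw hwc hws (E.pres hz rfl).1 0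
      have kα := k3 α hαy hα (Or.inl hαx)
      have kc := k3 _ h2 hzcc.symm (Or.inl hp'.1)
      have ez := k2 z hz rfl
      have ec := (kc x c hc).mpr rfl
      refine E'.P2aux hz hc hzc (by rwa [ez]) ?_ hαk (by rwa [ez]) (by rwa [ec])
        ((bad_congr kα z).2.mpr hb) ((bad_congr kα c).2.mpr hb')
        ((bad_congr (sm := sm) kα x).1.mpr hαx)
      rw [ec]
      exact (bad_congr kc y).2.mpr hg'
    · exact E.P2aux hc hz hzc.symm h2 hg hαk hα' hα hb' hb hαx
  · exact E.P2aux hz hc hzc h1 hg' hαk hα hα' hb hb' hαx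

end env

/-! ### The theorem -/

theorem ncard_delete (G : SimpleGraph V) [DecidableRel G.Adj] (x y : V) (hxy : G.Adj x y) :
    ((G.deleteEdges {s(x, y)}).neighborSet x).ncard + 1 ≤ G.degree x ∧
    ((G.deleteEdges {s(x, y)}).neighborSet y).ncard + 1 ≤ G.degree y ∧
    ∀ v, ((G.deleteEdges {s(x, y)}).neighborSet v).ncard ≤ G.degree v := by
  classical
  have hd : ∀ v, (G.neighborSet v).ncard = G.degree v := by
    intro v
    exact (congrArg Set.ncard (SimpleGraph.coe_neighborFinset G v)).symm.trans
      ((Set.ncard_coe_finset _).trans (SimpleGraph.card_neighborFinset_eq_degree G v))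
  have key : ∀ a b, G.Adj a b → s(a, b) = s(x, y) →
      ((G.deleteEdges {s(x, y)}).neighborSet a).ncard + 1 ≤ G.degree a := by
    intro a b hab he
    rw [← hd]
    apply Set.ncard_lt_ncard
    · refine ⟨fun u hu => (SimpleGraph.deleteEdges_adj.mp hu).1, fun h => ?_⟩
      have := h (show b ∈ G.neighborSet a from hab)
      exact (SimpleGraph.deleteEdges_adj.mp this).2 (by simp [he])
    · exact Set.toFinite _
  refine ⟨key x y hxy rfl, key y x hxy.symm Sym2.eq_swap, fun v => ?_⟩
  rw [← hd]
  exact Set.ncard_le_ncard (fun u hu => (SimpleGraph.deleteEdges_adj.mp hu).1) (Set.toFinite _)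

/-- Let `G` be a `Δ`-critical simple graph, `ε ∈ (0,1)`, `q = (1-ε)Δ`, `xy ∈ E(G)` with
`d(x) < εΔ`, and `φ ∈ C^Δ(G - xy)`. Then for every `z ∈ N(x, M_φ)`, one has
`φ_b(z) - {φ(xz)} ⊆ B_φ(x,y,q)`; moreover, for any two distinct `z₁, z₂ ∈ N(x, M_φ)`,
`φ_b(z₁) ∩ φ_b(z₂) = ∅`. -/
theorem statement7 (G : SimpleGraph V) [DecidableRel G.Adj] (hG : IsDeltaCritical G)
    (ε : ℝ) (hε : ε ∈ Set.Ioo (0 : ℝ) 1) (q : ℝ) (hq : q = (1 - ε) * G.maxDegree)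
    (x y : V) (hxy : G.Adj x y) (hx : (G.degree x : ℝ) < ε * G.maxDegree)
    (H : SimpleGraph V) (hH : H = G.deleteEdges {s(x, y)})
    (φ : V → V → ℕ) (hφ : IsEdgeColoring H G.maxDegree φ) :
    (∀ z ∈ NxM G H G.maxDegree φ q x y,
      phib G H G.maxDegree φ q z \ {φ x z} ⊆ Bset G H φ q x y) ∧
    ∀ z₁ ∈ NxM G H G.maxDegree φ q x y, ∀ z₂ ∈ NxM G H G.maxDegree φ q x y, z₁ ≠ z₂ →
      phib G H G.maxDegree φ q z₁ ∩ phib G H G.maxDegree φ q z₂ = ∅ := by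
  obtain ⟨d1, d2, d3⟩ := ncard_delete G x y hxy
  rw [← hH] at d1 d2 d3
  have E : Env G H G.maxDegree φ x y (fun v => (G.degree v : ℝ) < q) := by
    refine ⟨⟨?_, hφ, ?_⟩, hxy.ne, ?_, ?_, ?_, ?_⟩
    · intro h
      have h1 : chromIndex G ≤ G.maxDegree := Nat.sInf_le h
      rw [hG.2.1] at h1
      omega
    · intro u v huv
      by_cases h : s(u, v) = s(x, y)
      · exact Or.inr h
      · left
        rw [hH]
        exact SimpleGraph.deleteEdges_adj.mpr ⟨huv, by simpa using h⟩
    · rw [hH]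
      intro h
      exact (SimpleGraph.deleteEdges_adj.mp h).2 (by simp)
    · intro v hv
      have h1 : (G.degree x : ℝ) + G.degree v < G.maxDegree := by
        rw [hq] at hv
        linarith
      have h2 : G.degree x + G.degree v < G.maxDegree := by exact_mod_cast h1
      have := d3 v
      omega
    · exact d1.trans (G.degree_le_maxDegree x)
    · exact d2.trans (G.degree_le_maxDegree y)
  have hM : ∀ z ∈ NxM G H G.maxDegree φ q x y,
      H.Adj x z ∧ Bad H φ (fun v => (G.degree v : ℝ) < q) (φ x z) y := by
    rintro z ⟨hz, hm⟩
    refine ⟨hz, ?_⟩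
    rcases hm with (⟨-, h⟩ | h) | h
    · exact Or.inr h
    · exact absurd ⟨z, hz, rfl⟩ h.2
    · exact Or.inl h.2
  have hI : ∀ α, α ∈ Set.Icc 1 G.maxDegree → α ∈ Finset.Icc 1 G.maxDegree := by
    intro α h
    rw [Finset.mem_Icc]
    exact h
  constructor
  · rintro z hz α ⟨⟨hα, hb⟩, hne⟩
    obtain ⟨hz1, hz2⟩ := hM z hz
    obtain ⟨h1, h2⟩ := E.P1 hz1 hz2 (hI α hα) (by simpa using hne) hb
    refine ⟨h1, ?_⟩
    have h3 : α ∈ present H φ y := by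
      by_contra h
      exact h2 (Or.inl h)
    obtain ⟨u, hu, huc⟩ := h3
    refine ⟨u, hu, huc, ?_⟩
    by_contra h
    exact h2 (Or.inr ⟨u, hu, huc, not_le.mp h⟩)
  · intro z₁ h₁ z₂ h₂ hne
    rw [Set.eq_empty_iff_forall_notMem]
    rintro α ⟨⟨hα, hb⟩, ⟨-, hb'⟩⟩
    obtain ⟨a1, a2⟩ := hM z₁ h₁
    obtain ⟨b1, b2⟩ := hM z₂ h₂
    exact E.P2 a1 b1 hne a2 b2 (hI α hα) hb hb'
end

section
/- Let G be a Δ-critical simple graph, ε ∈ (0,1), q = (1−ε)Δ, and let xy ∈ E(G) with d(x) < εΔ and φ ∈ C^Δ(G−xy). Let z ∈ N(x, M_φ) and β ∈ B_φ(x,y,q). If β ∈ φ_b(z), then for every α ∈ M_φ(x,y,q) there exist z' ∈ N(x, B_φ) and u ∈ N(z') such that φ(xz') = β, φ(z'u) = α, and d(u) ≥ q. -/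
open Finset

variable {V : Type*}

variable [Fintype V]

/-! ### Auxiliary notions for the proof -/

/-- Color `a` is missing at `p` in `H`. -/
def MsC (H : SimpleGraph V) (φ : V → V → ℕ) (p : V) (a : ℕ) : Prop :=
  ∀ r, H.Adj p r → φ p r ≠ a

/-- Color `a` is missing at `p` in `H` or lies on an edge to a vertex satisfying `L`. -/
def WkC (H : SimpleGraph V) (L : V → Prop) (φ : V → V → ℕ) (p : V) (a : ℕ) : Prop :=
  ∀ r, H.Adj p r → φ p r = a → L r

/-- The two-colored subgraph. -/
def kGraph (H : SimpleGraph V) (φ : V → V → ℕ) (hs : ∀ u v, φ u v = φ v u) (a b : ℕ) :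
    SimpleGraph V where
  Adj u v := H.Adj u v ∧ (φ u v = a ∨ φ u v = b)
  symm := ⟨fun u v h => ⟨h.1.symm, by rw [hs v u]; exact h.2⟩⟩
  loopless := ⟨fun u h => H.loopless.irrefl u h.1⟩

/-- `S` is a union of two-colored components. -/
def KClosed (H : SimpleGraph V) (φ : V → V → ℕ) (a b : ℕ) (S : Set V) : Prop :=
  ∀ u v, H.Adj u v → (φ u v = a ∨ φ u v = b) → (u ∈ S ↔ v ∈ S)

theorem swap_exists (H : SimpleGraph V) (k : ℕ) (φ : V → V → ℕ) (hφ : IsEdgeColoring H k φ)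
    (a b : ℕ) (ha : a ∈ Finset.Icc 1 k) (hb : b ∈ Finset.Icc 1 k) (S : Set V)
    (hS : KClosed H φ a b S) :
    ∃ ψ, IsEdgeColoring H k ψ ∧
      (∀ u v, H.Adj u v → u ∈ S → ψ u v = Equiv.swap a b (φ u v)) ∧
      (∀ u v, H.Adj u v → u ∉ S → ψ u v = φ u v) := by
  classical
  obtain ⟨h1, h2, h3⟩ := hφ
  have hin : ∀ u v, H.Adj u v → u ∈ S →
      (if u ∈ S ∧ v ∈ S then Equiv.swap a b (φ u v) else φ u v) = Equiv.swap a b (φ u v) := by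
    intro u v huv hu
    by_cases hv : v ∈ S
    · simp [hu, hv]
    · have := hS u v huv
      have h4 : ¬ (φ u v = a ∨ φ u v = b) := fun h => hv ((this h).1 hu)
      push Not at h4
      rw [Equiv.swap_apply_of_ne_of_ne h4.1 h4.2]
      simp
  have hout : ∀ u v, H.Adj u v → u ∉ S →
      (if u ∈ S ∧ v ∈ S then Equiv.swap a b (φ u v) else φ u v) = φ u v := by
    intro u v huv hu
    simp [hu]
  refine ⟨fun u v => if u ∈ S ∧ v ∈ S then Equiv.swap a b (φ u v) else φ u v,
    ⟨?_, ?_, ?_⟩, hin, hout⟩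
  · intro u v
    simp only [h1 u v, and_comm]
  · intro u v huv
    by_cases hu : u ∈ S
    · simp only [hin u v huv hu]
      rw [Equiv.swap_apply_def]
      split_ifs
      · exact hb
      · exact ha
      · exact h2 huv
    · simp only [hout u v huv hu]
      exact h2 huv
  · intro v c d hc hd hcd
    by_cases hv : v ∈ S
    · simp only [hin v c hc hv, hin v d hd hv]
      exact fun h => h3 hc hd hcd ((Equiv.swap a b).injective h)
    · simp only [hout v c hc hv, hout v d hd hv]
      exact h3 hc hd hcd

theorem recolor_exists (H H' : SimpleGraph V) (k : ℕ) (φ : V → V → ℕ)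
    (hφ : IsEdgeColoring H k φ) (w v : V) (d : ℕ) (hd : d ∈ Finset.Icc 1 k)
    (hw : MsC H φ w d) (hv : MsC H φ v d)
    (hH : ∀ p r, H'.Adj p r → s(p, r) = s(w, v) ∨ H.Adj p r) :
    ∃ ψ, IsEdgeColoring H' k ψ ∧ ψ w v = d ∧ (∀ p r, s(p, r) ≠ s(w, v) → ψ p r = φ p r) := by
  classical
  obtain ⟨h1, h2, h3⟩ := hφ
  refine ⟨fun p r => if s(p, r) = s(w, v) then d else φ p r, ⟨?_, ?_, ?_⟩, by simp, ?_⟩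
  · intro p r
    simp only [Sym2.eq_swap (a := r) (b := p), h1 r p]
  · intro p r hpr
    simp only
    split_ifs with h
    · exact hd
    · exact h2 ((hH p r hpr).resolve_left h)
  · intro p r t hr ht hrt
    have hM : ∀ r t, H'.Adj p t → s(p, r) = s(w, v) → s(p, t) ≠ s(w, v) → φ p t ≠ d := by
      intro r t ht e1 e2
      have hA := (hH p t ht).resolve_left e2
      have : p = w ∨ p = v := by
        have : p ∈ s(w, v) := e1 ▸ Sym2.mem_mk_left p r
        simpa using this
      rcases this with rfl | rfl
      · exact hw t hA
      · exact hv t hA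
    simp only
    split_ifs with e1 e2 e2
    · exact absurd (Sym2.congr_right.1 (e1.trans e2.symm)) hrt
    · exact (hM r t ht e1 e2).symm
    · exact hM t r hr e2 e1
    · exact h3 ((hH p r hr).resolve_left e1) ((hH p t ht).resolve_left e2) hrt
  · intro p r h
    simp [h]

/-- Three vertices of degree at most one in a connected two-colored component: impossible. -/
theorem three_ends_s8 (H : SimpleGraph V) (k : ℕ) (φ : V → V → ℕ) (hφ : IsEdgeColoring H k φ)
    (a b : ℕ) (C : (kGraph H φ hφ.1 a b).ConnectedComponent)
    (T : Finset V) (hT : T.card = 3) (hTC : ∀ t ∈ T, t ∈ C.supp)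
    (hm : ∀ t ∈ T, MsC H φ t a ∨ MsC H φ t b) : False := by
  classical
  have hconn : C.toSimpleGraph.Connected := C.connected_toSimpleGraph
  have h1 := hconn.card_vert_le_card_edgeSet_add_one
  have h2 := C.toSimpleGraph.sum_degrees_eq_twice_card_edges
  have hadj : ∀ u v : C, C.toSimpleGraph.Adj u v → H.Adj u v ∧ (φ u v = a ∨ φ u v = b) := by
    intro u v h
    exact h
  have hdeg : ∀ u : C, C.toSimpleGraph.degree u ≤ 2 - (if (u : V) ∈ T then 1 else 0) := by
    intro u
    have key : ∀ s : Finset ℕ, (∀ v : C, C.toSimpleGraph.Adj u v → φ u v ∈ s) →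
        C.toSimpleGraph.degree u ≤ s.card := by
      intro s hs
      rw [← SimpleGraph.card_neighborFinset_eq_degree]
      refine Finset.card_le_card_of_injOn (fun v => φ u v) ?_ ?_
      · intro v hv
        exact hs v (by simpa using hv)
      · intro v hv w hw hvw
        by_contra hne
        have hv' : C.toSimpleGraph.Adj u v := by simpa using hv
        have hw' : C.toSimpleGraph.Adj u w := by simpa using hw
        exact hφ.2.2 (hadj _ _ hv').1 (hadj _ _ hw').1 (fun h => hne (Subtype.ext h)) hvw
    split_ifs with hu
    · rcases hm u hu with h | h
      · refine (key {b} ?_).trans (by simp)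
        intro v hv
        have := hadj _ _ hv
        simpa using this.2.resolve_left (h v this.1)
      · refine (key {a} ?_).trans (by simp)
        intro v hv
        have := hadj _ _ hv
        simpa using this.2.resolve_right (h v this.1)
    · refine (key {a, b} ?_).trans (Finset.card_le_two)
      intro v hv
      simpa using (hadj _ _ hv).2
  have h3 : ∑ u : C, (C.toSimpleGraph.degree u + (if (u : V) ∈ T then 1 else 0))
      ≤ ∑ u : C, 2 := by
    refine Finset.sum_le_sum fun u _ => ?_
    have := hdeg u
    split_ifs at this ⊢ <;> omega
  rw [Finset.sum_add_distrib, h2] at h3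
  have h4 : ∑ u : C, (if (u : V) ∈ T then 1 else 0) = 3 := by
    rw [← hT, Finset.sum_boole]
    simp only [Nat.cast_id]
    refine Finset.card_bij (fun u _ => (u : V)) ?_ ?_ ?_
    · intro u hu
      simpa using hu
    · intro u _ v _ h
      exact Subtype.ext h
    · intro t ht
      exact ⟨⟨t, hTC t ht⟩, by simpa using ht, rfl⟩
  rw [h4] at h3
  simp only [Finset.sum_const, Finset.card_univ, smul_eq_mul] at h3
  have h5 : C.toSimpleGraph.edgeFinset.card = Nat.card C.toSimpleGraph.edgeSet := by
    rw [Nat.card_eq_fintype_card, SimpleGraph.edgeFinset_card]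
  rw [h5] at h3
  rw [Nat.card_eq_fintype_card] at h1
  omega

/-- `G` minus the edge `xw`. -/
def dE (G : SimpleGraph V) (x w : V) : SimpleGraph V := G.deleteEdges {s(x, w)}

theorem dE_adj (G : SimpleGraph V) (x w p r : V) :
    (dE G x w).Adj p r ↔ G.Adj p r ∧ s(p, r) ≠ s(x, w) := by
  simp [dE, SimpleGraph.deleteEdges_adj]

/-- Elementarity of the end vertices of the uncolored edge. -/
theorem elem_edge (G : SimpleGraph V) (k : ℕ) (hN : ∀ φ, ¬ IsEdgeColoring G k φ)
    (x w : V) (φ : V → V → ℕ) (hφ : IsEdgeColoring (dE G x w) k φ)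
    (a : ℕ) (ha : a ∈ Finset.Icc 1 k) (hx : MsC (dE G x w) φ x a)
    (hw : MsC (dE G x w) φ w a) : False := by
  obtain ⟨ψ, h, -⟩ := recolor_exists (dE G x w) G k φ hφ x w a ha hx hw (by
    intro p r hpr
    by_cases h : s(p, r) = s(x, w)
    · exact Or.inl h
    · exact Or.inr ((dE_adj _ _ _ _ _).2 ⟨hpr, h⟩))
  exact hN ψ h

theorem chain_ends (G : SimpleGraph V) (k : ℕ) (hN : ∀ φ, ¬ IsEdgeColoring G k φ)
    (x w : V) (φ : V → V → ℕ) (hφ : IsEdgeColoring (dE G x w) k φ)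
    (e d : ℕ) (he : e ∈ Finset.Icc 1 k) (hd : d ∈ Finset.Icc 1 k)
    (hx : MsC (dE G x w) φ x e) (hw : MsC (dE G x w) φ w d) (S : Set V)
    (hS : KClosed (dE G x w) φ e d S) (hxS : x ∈ S) : w ∈ S := by
  by_contra hwS
  obtain ⟨ψ, h1, h2, h3⟩ := swap_exists _ k φ hφ e d he hd S hS
  refine elem_edge G k hN x w ψ h1 d hd ?_ ?_
  · intro r hr h
    rw [h2 x r hr hxS] at h
    have : φ x r = e := by
      apply (Equiv.swap e d).injective
      rw [h, Equiv.swap_apply_left]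
    exact hx r hr this
  · intro r hr h
    rw [h3 w r hr hwS] at h
    exact hw r hr h

theorem third_comp (G : SimpleGraph V) (k : ℕ) (hN : ∀ φ, ¬ IsEdgeColoring G k φ)
    (x w : V) (hxw : x ≠ w) (φ : V → V → ℕ) (hφ : IsEdgeColoring (dE G x w) k φ)
    (e d : ℕ) (he : e ∈ Finset.Icc 1 k) (hd : d ∈ Finset.Icc 1 k)
    (hx : MsC (dE G x w) φ x e) (hw : MsC (dE G x w) φ w d)
    (v : V) (hvx : v ≠ x) (hvw : v ≠ w)
    (hv : MsC (dE G x w) φ v e ∨ MsC (dE G x w) φ v d) :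
    ∃ S, KClosed (dE G x w) φ e d S ∧ v ∈ S ∧ x ∉ S ∧ w ∉ S := by
  classical
  set C := (kGraph (dE G x w) φ hφ.1 e d).connectedComponentMk v with hC
  have hcl : KClosed (dE G x w) φ e d C.supp := by
    intro p r hpr hc
    have hA : (kGraph (dE G x w) φ hφ.1 e d).Adj p r := ⟨hpr, hc⟩
    rw [SimpleGraph.ConnectedComponent.mem_supp_iff, SimpleGraph.ConnectedComponent.mem_supp_iff,
      SimpleGraph.ConnectedComponent.sound hA.reachable]
  have hvC : v ∈ C.supp := by simp [hC]
  have hxw1 : x ∈ C.supp → w ∈ C.supp :=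
    chain_ends G k hN x w φ hφ e d he hd hx hw _ hcl
  have hxw2 : w ∈ C.supp → x ∈ C.supp := by
    intro h
    by_contra hn
    exact chain_ends G k hN x w φ hφ e d he hd hx hw (C.supp)ᶜ
      (fun p r hpr hc => not_congr (hcl p r hpr hc)) hn h
  have hnot : x ∉ C.supp := by
    intro hxC
    refine three_ends_s8 _ k φ hφ e d C {v, x, w} ?_ ?_ ?_
    · rw [Finset.card_eq_three]
      exact ⟨v, x, w, hvx, hvw, hxw, rfl⟩
    · intro t ht
      simp only [Finset.mem_insert, Finset.mem_singleton] at ht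
      rcases ht with rfl | rfl | rfl
      · exact hvC
      · exact hxC
      · exact hxw1 hxC
    · intro t ht
      simp only [Finset.mem_insert, Finset.mem_singleton] at ht
      rcases ht with rfl | rfl | rfl
      · exact hv
      · exact Or.inl hx
      · exact Or.inr hw
  exact ⟨C.supp, hcl, hvC, hnot, fun h => hnot (hxw2 h)⟩

/-- Low vertices share missing colors with `x`, avoiding any given color. -/
def LowProp (G : SimpleGraph V) (k : ℕ) (x : V) (L : V → Prop) : Prop :=
  ∀ w φ, G.Adj x w → ∀ v f, L v →
    ∃ e ∈ Finset.Icc 1 k, e ≠ f ∧ MsC (dE G x w) φ x e ∧ MsC (dE G x w) φ v e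

theorem step (G : SimpleGraph V) (k : ℕ) (hN : ∀ φ, ¬ IsEdgeColoring G k φ)
    (L : V → Prop) (x : V) (hL : LowProp G k x L)
    (w : V) (hxw : G.Adj x w) (φ : V → V → ℕ) (hφ : IsEdgeColoring (dE G x w) k φ)
    (c d f : ℕ) (hd : d ∈ Finset.Icc 1 k)
    (hc : WkC (dE G x w) L φ w c) (hwd : MsC (dE G x w) φ w d) :
    ∃ ψ, IsEdgeColoring (dE G x w) k ψ ∧ MsC (dE G x w) ψ w c ∧
      (∀ r, (dE G x w).Adj x r → ψ x r = φ x r) ∧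
      (∀ a, WkC (dE G x w) L φ w a → WkC (dE G x w) L ψ w a) ∧
      (∀ r, (dE G x w).Adj w r → φ w r ≠ c → ψ w r = φ w r) ∧
      (∀ p a, a ≠ d → (MsC (dE G x w) φ x a → a = f) →
        WkC (dE G x w) L φ p a → WkC (dE G x w) L ψ p a) := by
  by_cases hm : MsC (dE G x w) φ w c
  · exact ⟨φ, hφ, hm, fun _ _ => rfl, fun _ h => h, fun _ _ _ => rfl, fun _ _ _ _ h => h⟩
  simp only [MsC, not_forall, not_not] at hm
  obtain ⟨v, hwv, hcv⟩ := hm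
  have hLv := hc v hwv hcv
  have hvx : v ≠ x := by
    rintro rfl
    exact ((dE_adj _ _ _ _ _).1 hwv).2 Sym2.eq_swap
  have hvw : v ≠ w := hwv.ne'
  obtain ⟨e, he, hef, hxe, hve⟩ := hL w φ hxw v f hLv
  obtain ⟨S, hS, hvS, hxS, hwS⟩ := third_comp G k hN x w hxw.ne φ hφ e d he hd hxe hwd v hvx hvw
    (Or.inl hve)
  obtain ⟨ψ, h1, h2, h3⟩ := swap_exists _ k φ hφ e d he hd S hS
  have hwd' : MsC (dE G x w) ψ w d := by
    intro r hr
    rw [h3 w r hr hwS]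
    exact hwd r hr
  have hvd' : MsC (dE G x w) ψ v d := by
    intro r hr h
    rw [h2 v r hr hvS] at h
    have : φ v r = e := by
      apply (Equiv.swap e d).injective
      rw [h, Equiv.swap_apply_left]
    exact hve r hr this
  obtain ⟨θ, g1, g2, g3⟩ := recolor_exists (dE G x w) (dE G x w) k ψ h1 w v d hd hwd' hvd'
    (fun p r h => Or.inr h)
  have hcd : c ≠ d := by
    rintro rfl
    exact hwd v hwv hcv
  have hθw : ∀ r, r ≠ v → (dE G x w).Adj w r → θ w r = φ w r := by
    intro r hrv hr
    rw [g3 w r (fun h => hrv (Sym2.congr_right.1 h)), h3 w r hr hwS]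
  refine ⟨θ, g1, ?_, ?_, ?_, ?_, ?_⟩
  · intro r hr
    by_cases hrv : r = v
    · rw [hrv, g2]
      exact hcd.symm
    · rw [hθw r hrv hr, ← hcv]
      exact hφ.2.2 hr hwv hrv
  · intro r hr
    rw [g3 x r, h3 x r hr hxS]
    intro h
    have : x ∈ s(w, v) := h ▸ Sym2.mem_mk_left x r
    simp only [Sym2.mem_iff] at this
    rcases this with h | h
    · exact hxw.ne h
    · exact hvx h.symm
  · intro a ha r hr hra
    by_cases hrv : r = v
    · rw [hrv]
      exact hLv
    · rw [hθw r hrv hr] at hra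
      exact ha r hr hra
  · intro r hr hrc
    refine hθw r ?_ hr
    rintro rfl
    exact hrc hcv
  · intro p a had haf ha r hr hra
    have hae : a ≠ e := by
      rintro rfl
      exact hef (haf hxe)
    by_cases hs : s(p, r) = s(w, v)
    · exfalso
      have : θ p r = d := by
        rcases Sym2.eq_iff.1 hs with ⟨rfl, rfl⟩ | ⟨rfl, rfl⟩
        · exact g2
        · rw [g1.1]
          exact g2
      exact had (hra.symm.trans this)
    · rw [g3 p r hs] at hra
      by_cases hpS : p ∈ S
      · rw [h2 p r hr hpS] at hra
        apply ha r hr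
        apply (Equiv.swap e d).injective
        rw [hra, Equiv.swap_apply_of_ne_of_ne hae had]
      · rw [h3 p r hr hpS] at hra
        exact ha r hr hra

theorem move (G : SimpleGraph V) (k : ℕ) (hN : ∀ φ, ¬ IsEdgeColoring G k φ)
    (L : V → Prop) (x : V) (hL : LowProp G k x L)
    (w : V) (hxw : G.Adj x w) (φ : V → V → ℕ) (hφ : IsEdgeColoring (dE G x w) k φ)
    (t : V) (ht : (dE G x w).Adj x t)
    (d f : ℕ) (hd : d ∈ Finset.Icc 1 k)
    (hc : WkC (dE G x w) L φ w (φ x t)) (hwd : MsC (dE G x w) φ w d) :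
    ∃ ψ, IsEdgeColoring (dE G x t) k ψ ∧ MsC (dE G x t) ψ t (φ x t) ∧
      (∀ a, a ∈ Finset.Icc 1 k → MsC (dE G x w) φ x a → MsC (dE G x t) ψ x a) ∧
      (∀ r, G.Adj x r → r ≠ w → r ≠ t → ψ x r = φ x r) ∧
      (∀ p a, p ≠ w → p ≠ x → a ≠ d → (MsC (dE G x w) φ x a → a = f) →
        WkC (dE G x w) L φ p a → WkC (dE G x t) L ψ p a) := by
  obtain ⟨ψ, h1, h2, h3, h4, -, h5⟩ := step G k hN L x hL w hxw φ hφ (φ x t) d f hd hc hwd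
  have hGt := ((dE_adj _ _ _ _ _).1 ht).1
  have htw : t ≠ w := by
    rintro rfl
    exact ((dE_adj _ _ _ _ _).1 ht).2 rfl
  set H2 := dE G x w ⊓ dE G x t with hH2
  have hle : ∀ p r, H2.Adj p r → (dE G x w).Adj p r := fun p r h => h.1
  have h1' : IsEdgeColoring H2 k ψ :=
    ⟨h1.1, fun p r h => h1.2.1 (hle _ _ h),
      fun v a b ha hb hab => h1.2.2 (hle _ _ ha) (hle _ _ hb) hab⟩
  have hback : ∀ p r, (dE G x t).Adj p r → s(p, r) = s(x, w) ∨ H2.Adj p r := by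
    intro p r h
    by_cases hs : s(p, r) = s(x, w)
    · exact Or.inl hs
    · exact Or.inr ⟨(dE_adj _ _ _ _ _).2 ⟨((dE_adj _ _ _ _ _).1 h).1, hs⟩, h⟩
  obtain ⟨θ, g1, g2, g3⟩ := recolor_exists H2 (dE G x t) k ψ h1' x w (φ x t)
    (hφ.2.1 ht) (by
      intro r hr
      rw [← h3 t ht]
      refine h1.2.2 (hle _ _ hr) ht ?_
      rintro rfl
      exact ((dE_adj _ _ _ _ _).1 hr.2).2 rfl) (fun r hr => h2 r (hle _ _ hr)) hback
  refine ⟨θ, g1, ?_, ?_, ?_, ?_⟩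
  · intro r hr h
    have hs : s(t, r) ≠ s(x, w) := by
      intro h
      have : t ∈ s(x, w) := h ▸ Sym2.mem_mk_left t r
      simp only [Sym2.mem_iff] at this
      rcases this with h | h
      · exact hGt.ne h.symm
      · exact htw h
    rw [g3 t r hs] at h
    have hA := hle _ _ ((hback t r hr).resolve_left hs)
    have hrx : r ≠ x := by
      rintro rfl
      exact ((dE_adj _ _ _ _ _).1 hr).2 Sym2.eq_swap
    refine h1.2.2 hA ht.symm hrx ?_
    rw [h, h1.1 t x, h3 t ht]
  · intro a _ ha r hr
    by_cases hrw : r = w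
    · rw [hrw, g2]
      exact ha t ht
    · have hs : s(x, r) ≠ s(x, w) := fun h => hrw (Sym2.congr_right.1 h)
      have hA := hle _ _ ((hback x r hr).resolve_left hs)
      rw [g3 x r hs, h3 r hA]
      exact ha r hA
  · intro r hr hrw _
    have hs : s(x, r) ≠ s(x, w) := fun h => hrw (Sym2.congr_right.1 h)
    rw [g3 x r hs, h3 r ((dE_adj _ _ _ _ _).2 ⟨hr, hs⟩)]
  · intro p a hpw hpx had haf ha r hr h
    have hs : s(p, r) ≠ s(x, w) := by
      intro h
      have : p ∈ s(x, w) := h ▸ Sym2.mem_mk_left p r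
      simp only [Sym2.mem_iff] at this
      rcases this with h | h
      · exact hpx h
      · exact hpw h
    rw [g3 p r hs] at h
    exact h5 p a had haf ha r (hle _ _ ((hback p r hr).resolve_left hs)) h

theorem caseOne (G : SimpleGraph V) (k : ℕ) (hN : ∀ φ, ¬ IsEdgeColoring G k φ)
    (L : V → Prop) (x : V) (hL : LowProp G k x L)
    (y : V) (hxy : G.Adj x y) (φ : V → V → ℕ) (hφ : IsEdgeColoring (dE G x y) k φ)
    (d : ℕ) (hd : d ∈ Finset.Icc 1 k) (hyd : MsC (dE G x y) φ y d)
    (z z' : V) (hz : (dE G x y).Adj x z) (hz' : (dE G x y).Adj x z') (hzz : z ≠ z')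
    (hy : WkC (dE G x y) L φ y (φ x z)) (hyb : ¬ MsC (dE G x y) φ y (φ x z'))
    (hzb : WkC (dE G x y) L φ z (φ x z'))
    (a : ℕ) (ha : a ∈ Finset.Icc 1 k) (hxa : MsC (dE G x y) φ x a)
    (hza : WkC (dE G x y) L φ z' a) : False := by
  obtain ⟨ψ, h1, h2, h3, h4, h5⟩ := move G k hN L x hL y hxy φ hφ z hz d a hd hy hyd
  have hGz := ((dE_adj _ _ _ _ _).1 hz).1
  have hGz' := ((dE_adj _ _ _ _ _).1 hz').1
  have hzy : z ≠ y := by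
    rintro rfl
    exact ((dE_adj _ _ _ _ _).1 hz).2 rfl
  have hzy' : z' ≠ y := by
    rintro rfl
    exact ((dE_adj _ _ _ _ _).1 hz').2 rfl
  have hb : ψ x z' = φ x z' := h4 z' hGz' hzy' hzz.symm
  have hzb1 : WkC (dE G x z) L ψ z (ψ x z') := by
    rw [hb]
    refine h5 z _ hzy hGz.ne' ?_ ?_ hzb
    · intro h
      exact hyb (h ▸ hyd)
    · intro h
      exact absurd rfl (h z' hz')
  have hza1 : WkC (dE G x z) L ψ z' a := by
    refine h5 z' a hzy' hGz'.ne' ?_ (fun _ => rfl) hza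
    rintro rfl
    exact elem_edge G k hN x y φ hφ a ha hxa hyd
  have hxa1 := h3 a ha hxa
  have hz1 : (dE G x z).Adj x z' :=
    (dE_adj _ _ _ _ _).2 ⟨hGz', fun h => hzz (Sym2.congr_right.1 h).symm⟩
  obtain ⟨θ, g1, g2, g3, g4, g5⟩ := move G k hN L x hL z hGz ψ h1 z' hz1 (φ x z) a
    (hφ.2.1 hz) hzb1 h2
  have hza2 : WkC (dE G x z') L θ z' a :=
    g5 z' a hzz.symm hGz'.ne' (fun h => hxa z hz h.symm) (fun _ => rfl) hza1
  have hxa2 := g3 a ha hxa1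
  obtain ⟨ρ, r1, r2, r3, -⟩ := step G k hN L x hL z' hGz' θ g1 a (ψ x z') a (h1.2.1 hz1) hza2 g2
  refine elem_edge G k hN x z' ρ r1 a ha ?_ r2
  intro r hr
  rw [r3 r hr]
  exact hxa2 r hr

theorem caseTwo (G : SimpleGraph V) (k : ℕ) (hN : ∀ φ, ¬ IsEdgeColoring G k φ)
    (L : V → Prop) (x : V) (hL : LowProp G k x L)
    (y : V) (hxy : G.Adj x y)
    (hMs : ∀ φ, (∃ d ∈ Finset.Icc 1 k, MsC (dE G x y) φ x d) ∧
      ∃ d ∈ Finset.Icc 1 k, MsC (dE G x y) φ y d)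
    (φ : V → V → ℕ) (hφ : IsEdgeColoring (dE G x y) k φ)
    (z z' : V) (hz : (dE G x y).Adj x z) (hz' : (dE G x y).Adj x z') (hzz : z ≠ z')
    (hy : WkC (dE G x y) L φ y (φ x z)) (hyb : ¬ MsC (dE G x y) φ y (φ x z'))
    (hzb : WkC (dE G x y) L φ z (φ x z'))
    (a : ℕ) (ha : a ∈ Finset.Icc 1 k) (hab : a ≠ φ x z')
    (hxa : MsC (dE G x y) φ x a ∨ WkC (dE G x y) L φ y a)
    (hza : WkC (dE G x y) L φ z' a) : False := by
  by_cases hxa' : MsC (dE G x y) φ x a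
  · obtain ⟨d, hd, hyd⟩ := (hMs φ).2
    exact caseOne G k hN L x hL y hxy φ hφ d hd hyd z z' hz hz' hzz hy hyb hzb a ha hxa' hza
  have hya := hxa.resolve_left hxa'
  have hGz' := ((dE_adj _ _ _ _ _).1 hz').1
  have hzy' : z' ≠ y := by
    rintro rfl
    exact ((dE_adj _ _ _ _ _).1 hz').2 rfl
  -- first make `a` missing at `y`
  obtain ⟨ψ, h1, h2, h3, h4, h5, h6, h7⟩ : ∃ ψ, IsEdgeColoring (dE G x y) k ψ ∧
      MsC (dE G x y) ψ y a ∧ (∀ r, (dE G x y).Adj x r → ψ x r = φ x r) ∧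
      WkC (dE G x y) L ψ y (φ x z) ∧ ¬ MsC (dE G x y) ψ y (φ x z') ∧
      WkC (dE G x y) L ψ z (φ x z') ∧ WkC (dE G x y) L ψ z' a := by
    by_cases hm : MsC (dE G x y) φ y a
    · exact ⟨φ, hφ, hm, fun _ _ => rfl, hy, hyb, hzb, hza⟩
    obtain ⟨d, hd, hyd⟩ := (hMs φ).2
    obtain ⟨ψ, h1, h2, h3, h4, h5, h6⟩ := step G k hN L x hL y hxy φ hφ a d a hd hya hyd
    refine ⟨ψ, h1, h2, h3, h4 _ hy, ?_, ?_, ?_⟩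
    · simp only [MsC, not_forall, not_not] at hyb ⊢
      obtain ⟨r, hr, hrb⟩ := hyb
      refine ⟨r, hr, ?_⟩
      rw [h5 r hr (by rw [hrb]; exact hab.symm), hrb]
    · refine h6 z _ ?_ ?_ hzb
      · intro h
        exact hyb (h ▸ hyd)
      · intro h
        exact absurd rfl (h z' hz')
    · refine h6 z' a ?_ (fun _ => rfl) hza
      rintro rfl
      exact hm hyd
  -- find the end vertex of the chain at `z'`
  obtain ⟨e, he, hxe, S, hS, hzS, hxS, hyS⟩ : ∃ e ∈ Finset.Icc 1 k, MsC (dE G x y) ψ x e ∧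
      ∃ S, KClosed (dE G x y) ψ e a S ∧ z' ∈ S ∧ x ∉ S ∧ y ∉ S := by
    by_cases hm : MsC (dE G x y) ψ z' a
    · obtain ⟨e, he, hxe⟩ := (hMs ψ).1
      obtain ⟨S, hS⟩ := third_comp G k hN x y hxy.ne ψ h1 e a he ha hxe h2 z' hGz'.ne' hzy'
        (Or.inr hm)
      exact ⟨e, he, hxe, S, hS⟩
    · simp only [MsC, not_forall, not_not] at hm
      obtain ⟨v, hv, hva⟩ := hm
      obtain ⟨e, he, -, hxe, hve⟩ := hL y ψ hxy v a (h7 v hv hva)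
      have hvx : v ≠ x := by
        rintro rfl
        apply hab
        rw [← hva, h1.1, h3 z' hz']
      have hvy : v ≠ y := by
        rintro rfl
        exact h2 z' hv.symm (by rw [h1.1, hva])
      obtain ⟨S, hS, hvS, hS2⟩ := third_comp G k hN x y hxy.ne ψ h1 e a he ha hxe h2 v hvx hvy
        (Or.inl hve)
      exact ⟨e, he, hxe, S, hS, (hS z' v hv (Or.inr hva)).2 hvS, hS2⟩
  obtain ⟨θ, g1, g2, g3⟩ := swap_exists _ k ψ h1 e a he ha S hS
  have hθx : ∀ r, (dE G x y).Adj x r → θ x r = φ x r := by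
    intro r hr
    rw [g3 x r hr hxS, h3 r hr]
  obtain ⟨d, hd, hyd⟩ := (hMs θ).2
  refine caseOne G k hN L x hL y hxy θ g1 d hd hyd z z' hz hz' hzz ?_ ?_ ?_ e he ?_ ?_
  · rw [hθx z hz]
    intro r hr h
    rw [g3 y r hr hyS] at h
    exact h4 r hr h
  · rw [hθx z' hz']
    intro h
    apply h5
    intro r hr
    rw [← g3 y r hr hyS]
    exact h r hr
  · rw [hθx z' hz']
    intro r hr h
    by_cases hzS : z ∈ S
    · rw [g2 z r hr hzS] at h
      apply h6 r hr
      apply (Equiv.swap e a).injective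
      rw [h, Equiv.swap_apply_of_ne_of_ne _ hab.symm]
      intro h'
      exact hxe z' hz' (by rw [h3 z' hz', h'])
    · rw [g3 z r hr hzS] at h
      exact h6 r hr h
  · intro r hr
    rw [g3 x r hr hxS]
    exact hxe r hr
  · intro r hr h
    rw [g2 z' r hr hzS] at h
    apply h7 r hr
    apply (Equiv.swap e a).injective
    rw [h, Equiv.swap_apply_right]

theorem exists_missing_s8 (G : SimpleGraph V) [DecidableRel G.Adj] (k : ℕ) (x w : V)
    (hxw : G.Adj x w) (φ : V → V → ℕ) (T : Finset ℕ) (hT : G.degree x + T.card ≤ k) :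
    ∃ e ∈ Finset.Icc 1 k, e ∉ T ∧ MsC (dE G x w) φ x e := by
  classical
  have hlt : (((G.neighborFinset x).erase w).image (φ x) ∪ T).card < (Finset.Icc 1 k).card := by
    have h1 := Finset.card_union_le (((G.neighborFinset x).erase w).image (φ x)) T
    have h2 : (((G.neighborFinset x).erase w).image (φ x)).card ≤ _ := Finset.card_image_le
    have h3 : ((G.neighborFinset x).erase w).card = G.degree x - 1 := by
      rw [Finset.card_erase_of_mem (by simpa using hxw), SimpleGraph.card_neighborFinset_eq_degree]
    have h4 : 0 < G.degree x := (G.degree_pos_iff_exists_adj x).2 ⟨w, hxw⟩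
    rw [Nat.card_Icc]
    omega
  obtain ⟨e, he, hn⟩ := Finset.exists_mem_notMem_of_card_lt_card hlt
  rw [Finset.mem_union, not_or] at hn
  refine ⟨e, he, hn.2, ?_⟩
  intro r hr h
  have hr' := (dE_adj _ _ _ _ _).1 hr
  apply hn.1
  rw [Finset.mem_image]
  refine ⟨r, ?_, h⟩
  rw [Finset.mem_erase, SimpleGraph.mem_neighborFinset]
  refine ⟨?_, hr'.1⟩
  rintro rfl
  exact hr'.2 rfl

theorem dE_comm (G : SimpleGraph V) (x w : V) : dE G x w = dE G w x := by
  unfold dE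
  rw [Sym2.eq_swap]

theorem lowProp_of_degree (G : SimpleGraph V) [DecidableRel G.Adj] (k : ℕ) (x : V)
    (L : V → Prop) (h : ∀ v, L v → G.degree x + G.degree v + 1 ≤ k) : LowProp G k x L := by
  classical
  intro w φ hxw v f hv
  obtain ⟨e, he, hT, hx⟩ := exists_missing_s8 G k x w hxw φ
    (insert f ((G.neighborFinset v).image (φ v))) (by
      have h1 := Finset.card_insert_le f ((G.neighborFinset v).image (φ v))
      have h2 : ((G.neighborFinset v).image (φ v)).card ≤ _ := Finset.card_image_le
      rw [SimpleGraph.card_neighborFinset_eq_degree] at h2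
      have := h v hv
      omega)
  rw [Finset.mem_insert, not_or] at hT
  refine ⟨e, he, hT.1, hx, ?_⟩
  intro r hr hre
  apply hT.2
  rw [Finset.mem_image]
  exact ⟨r, by simpa using ((dE_adj _ _ _ _ _).1 hr).1, hre⟩

/-- Let `G` be a `Δ`-critical simple graph, `ε ∈ (0,1)`, `q = (1-ε)Δ`, `xy ∈ E(G)` with
`d(x) < εΔ`, and `φ ∈ C^Δ(G - xy)`. Let `z ∈ N(x, M_φ)` and `β ∈ B_φ(x,y,q)`. If
`β ∈ φ_b(z)`, then for every `α ∈ M_φ(x,y,q)` there exist `z' ∈ N(x, B_φ)` and `u ∈ N(z')`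
such that `φ(xz') = β`, `φ(z'u) = α`, and `d(u) ≥ q`. -/
theorem statement8 (G : SimpleGraph V) [DecidableRel G.Adj] (hG : IsDeltaCritical G)
    (ε : ℝ) (hε : ε ∈ Set.Ioo (0 : ℝ) 1) (q : ℝ) (hq : q = (1 - ε) * G.maxDegree)
    (x y : V) (hxy : G.Adj x y) (hx : (G.degree x : ℝ) < ε * G.maxDegree)
    (H : SimpleGraph V) (hH : H = G.deleteEdges {s(x, y)})
    (φ : V → V → ℕ) (hφ : IsEdgeColoring H G.maxDegree φ)
    (z : V) (hz : z ∈ NxM G H G.maxDegree φ q x y)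
    (β : ℕ) (hβ : β ∈ Bset G H φ q x y) (hβz : β ∈ phib G H G.maxDegree φ q z) :
    ∀ α ∈ Mset G H G.maxDegree φ q x y,
      ∃ z' u : V, z' ∈ NxB G H φ q x y ∧ G.Adj z' u ∧
        φ x z' = β ∧ φ z' u = α ∧ q ≤ (G.degree u : ℝ) := by
  intro α hα
  have hN : ∀ φ, ¬ IsEdgeColoring G G.maxDegree φ := by
    intro ψ hψ
    have h : chromIndex G ≤ G.maxDegree := Nat.sInf_le ⟨ψ, hψ⟩
    have := hG.2.1
    omega
  have hHd : H = dE G x y := hH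
  clear hH
  subst hHd
  have hL : LowProp G G.maxDegree x (fun r => (G.degree r : ℝ) < q) := by
    refine lowProp_of_degree G _ x _ ?_
    intro v hv
    have : (G.degree x : ℝ) + G.degree v < G.maxDegree := by
      rw [hq] at hv
      linarith
    exact_mod_cast this
  have hMs : ∀ φ, (∃ d ∈ Finset.Icc 1 G.maxDegree, MsC (dE G x y) φ x d) ∧
      ∃ d ∈ Finset.Icc 1 G.maxDegree, MsC (dE G x y) φ y d := by
    intro ψ
    constructor
    · obtain ⟨e, he, -, h⟩ := exists_missing_s8 G G.maxDegree x y hxy ψ ∅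
        (by simpa using G.degree_le_maxDegree x)
      exact ⟨e, he, h⟩
    · obtain ⟨e, he, -, h⟩ := exists_missing_s8 G G.maxDegree y x hxy.symm ψ ∅
        (by simpa using G.degree_le_maxDegree y)
      rw [dE_comm] at h
      exact ⟨e, he, h⟩
  obtain ⟨⟨z', hxz', hβz'⟩, w, hyw, hwβ, hwq⟩ := id hβ
  -- properties of colors in `M`
  have hM : ∀ a ∈ Mset G (dE G x y) G.maxDegree φ q x y, a ∈ Finset.Icc 1 G.maxDegree ∧ a ≠ β ∧
      (MsC (dE G x y) φ x a ∨ WkC (dE G x y) (fun r => (G.degree r : ℝ) < q) φ y a) := by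
    intro a ha
    rcases ha with (⟨⟨t, ht, hta⟩, u, hu, hua, huq⟩ | ⟨h1, h2⟩) | ⟨h1, h2⟩
    · refine ⟨hta ▸ hφ.2.1 ht, ?_, Or.inr ?_⟩
      · intro hab
        have huw : u = w := by
          by_contra hne
          exact hφ.2.2 hu hyw hne (by rw [hua, hwβ, hab])
        rw [huw] at huq
        linarith
      · intro r hr hra
        have : r = u := by
          by_contra hne
          exact hφ.2.2 hr hu hne (by rw [hra, hua])
        subst this
        exact huq
    · refine ⟨by simpa using h1, ?_, Or.inl fun r hr h => h2 ⟨r, hr, h⟩⟩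
      rintro rfl
      exact h2 ⟨z', hxz', hβz'⟩
    · refine ⟨by simpa using h1, ?_, Or.inr fun r hr h => absurd ⟨r, hr, h⟩ h2⟩
      rintro rfl
      exact h2 ⟨w, hyw, hwβ⟩
  obtain ⟨hxz, hzM⟩ := hz
  obtain ⟨-, hτβ, hτ⟩ := hM _ hzM
  obtain ⟨hα1, hαβ, hα2⟩ := hM _ hα
  by_contra hcon
  have hzz : z ≠ z' := by
    rintro rfl
    exact hτβ hβz'
  refine caseTwo G G.maxDegree hN (fun r => (G.degree r : ℝ) < q) x hL y hxy hMs φ hφ z z'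
    hxz hxz' hzz (hτ.resolve_left fun h => h z hxz rfl) ?_ ?_ α hα1 (hβz' ▸ hαβ) hα2 ?_
  · intro h
    exact h w hyw (by rw [hwβ, hβz'])
  · rw [hβz']
    intro r hr hrb
    rcases hβz.2 with h | ⟨v, hv, hvb, hvq⟩
    · exact absurd ⟨r, hr, hrb⟩ h
    · have : r = v := by
        by_contra hne
        exact hφ.2.2 hr hv hne (by rw [hrb, hvb])
      subst this
      exact hvq
  · intro r hr hra
    by_contra hq'
    exact hcon ⟨z', r, ⟨hxz', hβz'.symm ▸ hβ⟩, ((dE_adj _ _ _ _ _).1 hr).1, hβz', hra,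
      not_lt.1 hq'⟩
end
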